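/- arXiv:2110.06008 — 2 statements merged into one kernel-verified Lean document; each statement's English description precedes it below -/
import Mathlib

section
/- For every fixed α ≥ 1, every y ≥ 1/√2, and every x ∈ (0,1/2), the partial derivative with respect to x of the function x ↦ θ_{x,y}(b(x,y);α) (with y and α held fixed, and with the shift b(x,y) varying with x) is strictly positive. -/
/-- The shifted lattice theta function `θ_{x,y}(z;α)`. -/
noncomputable def latticeTheta (x y : ℝ) (z : ℝ × ℝ) (α : ℝ) : ℝ :=
  ∑' p : ℤ × ℤ,
    Real.exp (-(Real.pi * α / y) *
      (((p.1 : ℝ) + z.1) ^ 2 + 2 * x * ((p.1 : ℝ) + z.1) * ((p.2 : ℝ) + z.2) +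
        (x ^ 2 + y ^ 2) * ((p.2 : ℝ) + z.2) ^ 2))

/-- The special shift `b(x,y)`. -/
noncomputable def bPoint (x y : ℝ) : ℝ × ℝ :=
  ((x + (1 - x) * 4 * y ^ 2) / (8 * y ^ 2), (4 * y ^ 2 - 1) / (8 * y ^ 2))

open HurwitzZeta in
/-- Minus the odd Hurwitz kernel, recentred at `1/2`; it is positive on `(0, 1/2)`. -/
noncomputable def shiftedOddKernel (s u : ℝ) : ℝ :=
  -oddKernel ((1 / 2 + u : ℝ) : UnitAddCircle) s

theorem sq_succ_le_four_pow (m : ℕ) : ((m : ℝ) + 1) ^ 2 ≤ 4 ^ m := by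
  induction m with
  | zero => norm_num
  | succ k ih =>
    push_cast
    rw [pow_succ (4 : ℝ)]
    nlinarith [(Nat.cast_nonneg k : (0 : ℝ) ≤ k)]

theorem abs_sin_nat_mul_le (n : ℕ) (t : ℝ) : |Real.sin (n * t)| ≤ n * |Real.sin t| := by
  induction n with
  | zero => simp
  | succ k ih =>
    have h : ((k + 1 : ℕ) : ℝ) * t = k * t + t := by push_cast; ring
    rw [h, Real.sin_add]
    have h1 : |Real.sin (k * t) * Real.cos t| ≤ |Real.sin (k * t)| := by
      rw [abs_mul]; exact mul_le_of_le_one_right (abs_nonneg _) (Real.abs_cos_le_one _)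
    have h2 : |Real.cos (k * t) * Real.sin t| ≤ |Real.sin t| := by
      rw [abs_mul]; exact mul_le_of_le_one_left (abs_nonneg _) (Real.abs_cos_le_one _)
    push_cast
    linarith [abs_add_le (Real.sin (k * t) * Real.cos t) (Real.cos (k * t) * Real.sin t)]

/-- A lower bound for a sum whose tail is bounded below by a geometric series. -/
theorem HasSum.sum_sub_geometric_le {f : ℕ → ℝ} {S C ρ : ℝ} (hf : HasSum f S) (k : ℕ)
    (hρ : 0 ≤ ρ) (hρ1 : ρ < 1) (h : ∀ m, -(C * ρ ^ (m + 1)) ≤ f (m + k)) :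
    ∑ i ∈ Finset.range k, f i - C * ρ / (1 - ρ) ≤ S := by
  have hg := ((hasSum_geometric_of_lt_one hρ hρ1).mul_left (C * ρ)).neg
  have hk := (hasSum_nat_add_iff' k).mpr hf
  have := hasSum_le (fun m => le_trans (le_of_eq (by ring)) (h m)) hg hk
  rw [div_eq_mul_inv]
  linarith

section Gaussian

theorem gaussian_mul_exp (z c d : ℝ) :
    Real.exp (-z * (c - d) ^ 2) = Real.exp (-z * (c + d) ^ 2) * Real.exp (4 * z * c * d) := by
  rw [← Real.exp_add]; ring_nf

theorem le_gaussian_diff (z c d : ℝ) (h : d ≤ c) :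
    Real.exp (-z * (c + d) ^ 2) * (d * (4 * z * c * (c - d) - 2)) ≤
      (c - d) * Real.exp (-z * (c - d) ^ 2) - (c + d) * Real.exp (-z * (c + d) ^ 2) := by
  rw [gaussian_mul_exp]
  have h1 : (c - d) * (4 * z * c * d + 1) ≤ (c - d) * Real.exp (4 * z * c * d) :=
    mul_le_mul_of_nonneg_left (Real.add_one_le_exp _) (by linarith)
  nlinarith [mul_le_mul_of_nonneg_left h1 (Real.exp_pos (-z * (c + d) ^ 2)).le]

theorem gaussian_diff_le (z c d : ℝ) (hd : 0 ≤ d) (hc : 0 ≤ c) :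
    (c - d) * Real.exp (-z * (c - d) ^ 2) - (c + d) * Real.exp (-z * (c + d) ^ 2) ≤
      Real.exp (-z * (c - d) ^ 2) * ((c + d) * (4 * z * c * d)) := by
  have h0 : Real.exp (-z * (c + d) ^ 2) =
      Real.exp (-z * (c - d) ^ 2) * Real.exp (-(4 * z * c * d)) := by
    rw [← Real.exp_add]; ring_nf
  rw [h0]
  have h1 : (c + d) * (-(4 * z * c * d) + 1) ≤ (c + d) * Real.exp (-(4 * z * c * d)) :=
    mul_le_mul_of_nonneg_left (Real.add_one_le_exp _) (by linarith)
  nlinarith [mul_le_mul_of_nonneg_left h1 (Real.exp_pos (-z * (c - d) ^ 2)).le,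
    mul_nonneg hd (Real.exp_pos (-z * (c - d) ^ 2)).le]

end Gaussian

namespace shiftedOddKernel

open HurwitzZeta

theorem neg_right (s u : ℝ) : shiftedOddKernel s (-u) = -shiftedOddKernel s u := by
  have h : ((1 / 2 + -u : ℝ) : UnitAddCircle) = -((1 / 2 + u : ℝ) : UnitAddCircle) := by
    rw [← AddCircle.coe_neg, ← AddCircle.coe_add_period (1 : ℝ) (-(1 / 2 + u))]
    congr 1
    ring
  rw [shiftedOddKernel, shiftedOddKernel, h, oddKernel_neg]

theorem hasSum_sin {s : ℝ} (hs : 0 < s) (u : ℝ) :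
    HasSum (fun n : ℕ => -(1 / s ^ (3 / 2 : ℝ)) *
      (2 * n * Real.sin (n * (2 * Real.pi * (1 / 2 + u))) *
        Real.exp (-Real.pi / s) ^ (n ^ 2))) (shiftedOddKernel s u) := by
  have h := (hasSum_nat_sinKernel (1 / 2 + u) (one_div_pos.mpr hs)).mul_left
    (-(1 / s ^ (3 / 2 : ℝ)))
  rw [shiftedOddKernel, oddKernel_functional_equation, ← neg_mul]
  refine h.congr_fun fun n => ?_
  rw [← Real.exp_nat_mul]
  congr 3
  · ring_nf
  · push_cast; ring_nf

theorem abs_sin_shift (u : ℝ) :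
    |Real.sin (2 * Real.pi * (1 / 2 + u))| = |Real.sin (2 * Real.pi * u)| := by
  have : 2 * Real.pi * (1 / 2 + u) = 2 * Real.pi * u + Real.pi := by ring
  rw [this, Real.sin_add_pi, abs_neg]

theorem abs_le_mul_abs_sin_of_large {s : ℝ} (hs : 1 ≤ s) (u : ℝ) :
    |shiftedOddKernel s u| ≤ 2 / 3 * s ^ 2 * |Real.sin (2 * Real.pi * u)| := by
  have hs0 : 0 < s := by linarith
  have hz := hasSum_zeta_two.mul_left (4 * s ^ 2 / Real.pi ^ 2 * |Real.sin (2 * Real.pi * u)|)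
  have h := (hasSum_sin hs0 u)
  have key := h.norm_le_of_bounded hz ?_
  · rw [Real.norm_eq_abs] at key
    refine key.trans (le_of_eq ?_)
    field_simp
    ring
  intro n
  rcases Nat.eq_zero_or_pos n with rfl | hn
  · simp
  have hn' : (0 : ℝ) < n := by exact_mod_cast hn
  have hpow : 1 ≤ s ^ (3 / 2 : ℝ) := Real.one_le_rpow hs (by norm_num)
  have hc : |-(1 / s ^ (3 / 2 : ℝ))| ≤ 1 := by
    rw [abs_neg, abs_of_nonneg (by positivity)]
    exact (div_le_one (by linarith)).mpr hpow
  have hsin := abs_sin_nat_mul_le n (2 * Real.pi * (1 / 2 + u))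
  rw [abs_sin_shift] at hsin
  have hexp : Real.exp (-Real.pi / s) ^ (n ^ 2) ≤ 2 * s ^ 2 / (Real.pi ^ 2 * n ^ 4) := by
    rw [← Real.exp_nat_mul]
    have : ((n ^ 2 : ℕ) : ℝ) * (-Real.pi / s) = -(Real.pi * n ^ 2 / s) := by push_cast; ring
    rw [this, Real.exp_neg, inv_le_comm₀ (Real.exp_pos _) (by positivity)]
    have hq := Real.quadratic_le_exp_of_nonneg (x := Real.pi * n ^ 2 / s) (by positivity)
    have : (2 * s ^ 2 / (Real.pi ^ 2 * n ^ 4))⁻¹ = (Real.pi * n ^ 2 / s) ^ 2 / 2 := by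
      field_simp
    have h0 : 0 ≤ Real.pi * n ^ 2 / s := by positivity
    linarith
  rw [Real.norm_eq_abs, abs_mul, abs_mul, abs_mul, abs_of_nonneg (by positivity : (0:ℝ) ≤ 2 * n),
    abs_of_nonneg (by positivity : (0:ℝ) ≤ Real.exp (-Real.pi / s) ^ (n ^ 2))]
  calc _ ≤ 1 * (2 * n * (n * |Real.sin (2 * Real.pi * u)|) *
        (2 * s ^ 2 / (Real.pi ^ 2 * n ^ 4))) := by gcongr
    _ = _ := by field_simp; ring

theorem le_of_small {s : ℝ} (hs : 0 < s) (hs3 : s ≤ 3) (u σ : ℝ) (hσ : |σ| = 1) :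
    let c := 2 * Real.exp (-Real.pi / s) / s ^ (3 / 2 : ℝ)
    c * (σ * Real.sin (2 * Real.pi * u) - 1 / 4 * |Real.sin (2 * Real.pi * u)|) ≤
      σ * shiftedOddKernel s u := by
  intro c
  set p := Real.exp (-Real.pi / s) with hp
  have hp0 : 0 < p := Real.exp_pos _
  have hc0 : 0 < c := by positivity
  have hp3 : 4 * p ^ 3 ≤ 1 / 5 := by
    have h1 : p ^ 3 ≤ Real.exp (-3) := by
      rw [hp, ← Real.exp_nat_mul]
      apply Real.exp_le_exp.mpr
      have : (((3 : ℕ) : ℝ)) * (-Real.pi / s) = -(3 * Real.pi / s) := by push_cast; ring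
      rw [this, neg_le_neg_iff, le_div_iff₀ hs]
      nlinarith [Real.pi_gt_three]
    have h2 : (20 : ℝ) ≤ Real.exp 3 := by
      have : Real.exp 3 = Real.exp 1 ^ 3 := by rw [← Real.exp_nat_mul]; norm_num
      rw [this]
      calc (20 : ℝ) ≤ 2.7182818283 ^ 3 := by norm_num
        _ ≤ _ := by gcongr; exact Real.exp_one_gt_d9.le
    have h3 : Real.exp (-3) ≤ 1 / 20 := by
      rw [Real.exp_neg, ← one_div]
      exact one_div_le_one_div_of_le (by norm_num) h2
    linarith
  have key := ((hasSum_sin hs u).mul_left σ).sum_sub_geometric_le 2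
    (C := c * |Real.sin (2 * Real.pi * u)|) (ρ := 4 * p ^ 3) (by positivity) (by linarith) ?_
  · have hgeo : c * |Real.sin (2 * Real.pi * u)| * (4 * p ^ 3) / (1 - 4 * p ^ 3) ≤
        c * |Real.sin (2 * Real.pi * u)| * (1 / 4) := by
      rw [mul_div_assoc]
      refine mul_le_mul_of_nonneg_left ?_ (by positivity)
      rw [div_le_iff₀ (by linarith)]
      linarith
    have hsh : Real.sin (2 * Real.pi * (1 / 2 + u)) = -Real.sin (2 * Real.pi * u) := by
      rw [← Real.sin_add_pi]; ring_nf
    have hsum : ∑ i ∈ Finset.range 2, σ * (-(1 / s ^ (3 / 2 : ℝ)) *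
      (2 * (i : ℝ) * Real.sin (i * (2 * Real.pi * (1 / 2 + u))) * p ^ (i ^ 2))) =
        c * (σ * Real.sin (2 * Real.pi * u)) := by
      simp only [Finset.sum_range_succ, Finset.sum_range_zero, Nat.cast_zero, Nat.cast_one,
        one_mul, hsh, c]
      ring
    rw [hsum] at key
    linarith
  intro m
  refine (abs_le.mp ?_).1
  have hsin := abs_sin_nat_mul_le (m + 2) (2 * Real.pi * (1 / 2 + u))
  rw [abs_sin_shift] at hsin
  have hp1 : p ≤ 1 := by
    rw [hp]; apply Real.exp_le_one_iff.mpr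
    exact div_nonpos_of_nonpos_of_nonneg (by linarith [Real.pi_pos]) hs.le
  have hpp : p ^ ((m + 2) ^ 2) ≤ p * (p ^ 3) ^ (m + 1) := by
    rw [← pow_mul, ← pow_succ']
    exact pow_le_pow_of_le_one hp0.le hp1 (by nlinarith)
  have hsq : ((m + 2 : ℕ) : ℝ) ^ 2 ≤ 4 ^ (m + 1) := by
    have := sq_succ_le_four_pow (m + 1)
    push_cast at this ⊢
    linarith
  rw [abs_mul, abs_mul, abs_mul, abs_mul, hσ, abs_neg,
    abs_of_nonneg (by positivity : (0:ℝ) ≤ 1 / s ^ (3 / 2 : ℝ)),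
    abs_of_nonneg (by positivity : (0:ℝ) ≤ 2 * ((m + 2 : ℕ) : ℝ)),
    abs_of_nonneg (by positivity : (0:ℝ) ≤ p ^ ((m + 2) ^ 2))]
  calc _ ≤ 1 * (1 / s ^ (3 / 2 : ℝ) * (2 * ((m + 2 : ℕ) : ℝ) *
          (((m + 2 : ℕ) : ℝ) * |Real.sin (2 * Real.pi * u)|) * (p * (p ^ 3) ^ (m + 1)))) := by
        gcongr
    _ = 1 / s ^ (3 / 2 : ℝ) * (2 * (((m + 2 : ℕ) : ℝ) ^ 2 *
          |Real.sin (2 * Real.pi * u)|) * (p * (p ^ 3) ^ (m + 1))) := by ring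
    _ ≤ 1 / s ^ (3 / 2 : ℝ) * (2 * (4 ^ (m + 1) *
          |Real.sin (2 * Real.pi * u)|) * (p * (p ^ 3) ^ (m + 1))) := by gcongr
    _ = _ := by simp only [c, mul_pow]; ring

theorem ge_of_le_quarter {s x : ℝ} (hs : 3 ≤ s) (hx0 : 0 < x) (hx : x ≤ 1 / 4) :
    Real.exp (-(9 / 16 * (Real.pi * s))) / 4 * Real.sin (2 * Real.pi * x) ≤
      shiftedOddKernel s x := by
  set z := Real.pi * s with hz
  have hz9 : 9 ≤ z := by nlinarith [Real.pi_gt_three]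
  have h := ((hasSum_int_oddKernel (1 / 2 + x) (by linarith : 0 < s)).nat_add_neg_add_one).neg
  have key := h.sum_sub_geometric_le 1 (C := 0) (ρ := 0) le_rfl one_pos ?_
  · simp only [Finset.sum_range_one, Nat.cast_zero] at key
    push_cast at key
    have h1 := le_gaussian_diff z (1 / 2) x (by linarith)
    have h2 : Real.exp (-(9 / 16 * z)) ≤ Real.exp (-z * (1 / 2 + x) ^ 2) := by
      apply Real.exp_le_exp.mpr
      have : (1 / 2 + x) ^ 2 ≤ 9 / 16 := by nlinarith
      nlinarith
    have h3 : 5 / 2 * x ≤ x * (4 * z * (1 / 2) * (1 / 2 - x) - 2) := by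
      have : 5 / 2 ≤ 4 * z * (1 / 2) * (1 / 2 - x) - 2 := by nlinarith
      nlinarith
    have h4 : Real.sin (2 * Real.pi * x) ≤ 2 * Real.pi * x := Real.sin_le (by positivity)
    have h5 : Real.exp (-(9 / 16 * z)) / 4 * Real.sin (2 * Real.pi * x) ≤
        Real.exp (-(9 / 16 * z)) * (5 / 2 * x) := by
      have : Real.sin (2 * Real.pi * x) ≤ 10 * x := by nlinarith [Real.pi_lt_four]
      nlinarith [Real.exp_pos (-(9 / 16 * z))]
    have h6 : Real.exp (-(9 / 16 * z)) * (5 / 2 * x) ≤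
        Real.exp (-z * (1 / 2 + x) ^ 2) * (x * (4 * z * (1 / 2) * (1 / 2 - x) - 2)) := by
      gcongr
    have e1 : -Real.pi * (0 + (1 / 2 + x)) ^ 2 * s = -z * (1 / 2 + x) ^ 2 := by rw [hz]; ring
    have e2 : -Real.pi * (-1 + (1 / 2 + x)) ^ 2 * s = -z * (1 / 2 - x) ^ 2 := by
      rw [hz]; ring
    simp only [e1, e2] at key
    rw [shiftedOddKernel]
    linarith
  intro m
  have hm : (0 : ℝ) ≤ m := Nat.cast_nonneg m
  have h1 := le_gaussian_diff z (m + 1 + 1 / 2) x (by linarith)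
  have h3 : 0 ≤ x * (4 * z * (m + 1 + 1 / 2) * (m + 1 + 1 / 2 - x) - 2) := by
    have : 9 ≤ z * (m + 1 + 1 / 2) := by nlinarith
    have : 2 ≤ 4 * (z * (m + 1 + 1 / 2)) * (m + 1 + 1 / 2 - x) := by nlinarith
    exact mul_nonneg hx0.le (by linarith)
  have h4 := mul_nonneg (Real.exp_pos (-z * (m + 1 + 1 / 2 + x) ^ 2)).le h3
  push_cast
  have e1 : -Real.pi * ((m:ℝ) + 1 + (1 / 2 + x)) ^ 2 * s = -z * (m + 1 + 1 / 2 + x) ^ 2 := by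
    rw [hz]; ring
  have e2 : -Real.pi * (-((m:ℝ) + 1 + 1) + (1 / 2 + x)) ^ 2 * s =
      -z * (m + 1 + 1 / 2 - x) ^ 2 := by
    rw [hz]; ring
  simp only [e1, e2]
  linarith

theorem exp_estimates {z : ℝ} (hz9 : 9 ≤ z) :
    Real.exp (-(9 / 16 * z)) ≤ 1 / 80 ∧
      Real.exp (-(9 / 16 * z)) * (5 * z * (20 / 19) + 2) ≤ Real.exp (-(z / 16)) := by
  set Q := Real.exp (-(z / 2)) with hQ
  set T := Real.exp (-(z / 16)) with hT
  have hQ0 : 0 < Q := Real.exp_pos _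
  have hT0 : 0 < T := Real.exp_pos _
  have hRT : Real.exp (-(9 / 16 * z)) = T * Q := by rw [hT, hQ, ← Real.exp_add]; ring_nf
  have hT1 : T ≤ 1 := Real.exp_le_one_iff.mpr (by linarith)
  have hQb : Q * (80 + 40 * (z - 9)) ≤ 1 := by
    have h1 : (80 : ℝ) ≤ Real.exp (9 / 2) := by
      have e : Real.exp (9 / 2) = Real.exp 1 ^ 4 * Real.exp (1 / 2) := by
        rw [← Real.exp_nat_mul, ← Real.exp_add]; norm_num
      rw [e]
      have h2 : (3 / 2 : ℝ) ≤ Real.exp (1 / 2) := by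
        linarith [Real.add_one_le_exp (1 / 2 : ℝ)]
      calc (80 : ℝ) ≤ 2.7182818283 ^ 4 * (3 / 2) := by norm_num
        _ ≤ _ := by gcongr; exact Real.exp_one_gt_d9.le
    have h3 : 80 + 40 * (z - 9) ≤ Real.exp (z / 2) := by
      have e : Real.exp (z / 2) = Real.exp (9 / 2) * Real.exp ((z - 9) / 2) := by
        rw [← Real.exp_add]; ring_nf
      rw [e]
      nlinarith [Real.add_one_le_exp ((z - 9) / 2)]
    have h4 : Q * Real.exp (z / 2) = 1 := by rw [hQ, ← Real.exp_add]; simp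
    nlinarith
  have hQ4 : Q ≤ 1 / 80 := by nlinarith
  have h5 : Q * (5 * z * (20 / 19) + 2) ≤ 1 := by nlinarith
  rw [hRT]
  constructor <;> nlinarith

theorem ge_of_quarter_le {s x : ℝ} (hs : 3 ≤ s) (hx0 : 1 / 4 ≤ x) (hx : x < 1 / 2) :
    Real.exp (-(9 / 16 * (Real.pi * s))) / 4 * Real.sin (2 * Real.pi * x) ≤
      shiftedOddKernel s x := by
  obtain ⟨v, rfl⟩ : ∃ v, x = 1 / 2 - v := ⟨1 / 2 - x, by ring⟩
  have hv0 : 0 < v := by linarith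
  have hv : v ≤ 1 / 4 := by linarith
  set z := Real.pi * s with hz
  have hz9 : 9 ≤ z := by nlinarith [Real.pi_gt_three]
  have hG : shiftedOddKernel s (1 / 2 - v) = oddKernel (v : UnitAddCircle) s := by
    rw [← neg_neg (oddKernel _ s), ← oddKernel_neg, shiftedOddKernel, ← AddCircle.coe_neg,
      ← AddCircle.coe_add_period (1 : ℝ) (-v)]
    congr 3
    ring
  have hsin : Real.sin (2 * Real.pi * (1 / 2 - v)) ≤ 8 * v := by
    have : 2 * Real.pi * (1 / 2 - v) = Real.pi - 2 * Real.pi * v := by ring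
    rw [this, Real.sin_pi_sub]
    have := Real.sin_le (x := 2 * Real.pi * v) (by positivity)
    nlinarith [Real.pi_lt_four]
  set R := Real.exp (-(9 / 16 * z)) with hR
  set T := Real.exp (-(z / 16)) with hT
  have hR0 : 0 < R := Real.exp_pos _
  obtain ⟨hR4, hRT⟩ : R ≤ 1 / 80 ∧ R * (5 * z * (20 / 19) + 2) ≤ T := exp_estimates hz9
  have h := (hasSum_int_oddKernel v (by linarith : 0 < s)).nat_add_neg
  have key := h.sum_sub_geometric_le 1 (C := 5 * z * v / 4) (ρ := 4 * R) (by positivity)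
    (by linarith) ?_
  · simp only [Finset.sum_range_one] at key
    push_cast at key
    simp only [neg_zero, zero_add] at key
    have e1 : -Real.pi * v ^ 2 * s = -z * v ^ 2 := by rw [hz]; ring
    rw [e1] at key
    have h2 : T ≤ Real.exp (-z * v ^ 2) := by
      apply Real.exp_le_exp.mpr
      have : v ^ 2 ≤ 1 / 16 := by nlinarith
      nlinarith
    have h3 : 5 * z * v / 4 * (4 * R) / (1 - 4 * R) ≤ 5 * z * v * R * (20 / 19) := by
      rw [div_le_iff₀ (by linarith)]
      nlinarith [mul_nonneg (mul_nonneg (by linarith : (0:ℝ) ≤ 5 * z) hv0.le) hR0.le]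
    have h4 : R / 4 * Real.sin (2 * Real.pi * (1 / 2 - v)) ≤ 2 * R * v := by nlinarith
    have h6 : R * (5 * z * (20 / 19) + 2) * v ≤ T * v := by gcongr
    have h7 : T * v ≤ v * Real.exp (-z * v ^ 2) := by nlinarith
    rw [hG]
    linarith
  intro m
  have hm : (0 : ℝ) ≤ m := Nat.cast_nonneg m
  have h1 := gaussian_diff_le z (m + 1) v hv0.le (by linarith)
  have h2 : Real.exp (-z * ((m:ℝ) + 1 - v) ^ 2) ≤ R ^ (m + 1) := by
    rw [hR, ← Real.exp_nat_mul]
    apply Real.exp_le_exp.mpr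
    push_cast
    have : (9 / 16) * ((m:ℝ) + 1) ≤ (m + 1 - v) ^ 2 := by nlinarith
    nlinarith
  have h3 : ((m:ℝ) + 1 + v) * (4 * z * (m + 1) * v) ≤ 5 * z * v * 4 ^ m := by
    have := sq_succ_le_four_pow m
    have h5 : ((m:ℝ) + 1 + v) * (4 * z * (m + 1) * v) =
        4 * z * v * (((m:ℝ) + 1 + v) * (m + 1)) := by ring
    have h6 : ((m:ℝ) + 1 + v) * (m + 1) ≤ 5 / 4 * 4 ^ m := by nlinarith
    rw [h5]
    calc _ ≤ 4 * z * v * (5 / 4 * 4 ^ m) := by gcongr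
      _ = _ := by ring
  have h4 : Real.exp (-z * ((m:ℝ) + 1 - v) ^ 2) * (((m:ℝ) + 1 + v) * (4 * z * (m + 1) * v)) ≤
      R ^ (m + 1) * (5 * z * v * 4 ^ m) := by gcongr
  push_cast
  have e1 : -Real.pi * ((m:ℝ) + 1 + v) ^ 2 * s = -z * (m + 1 + v) ^ 2 := by
    rw [hz]; ring
  have e2 : -Real.pi * (-((m:ℝ) + 1) + v) ^ 2 * s = -z * (m + 1 - v) ^ 2 := by
    rw [hz]; ring
  simp only [e1, e2]
  have e3 : 5 * z * v / 4 * (4 * R) ^ (m + 1) = R ^ (m + 1) * (5 * z * v * 4 ^ m) := by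
    rw [mul_pow]; ring
  rw [e3]
  linarith

/-- Two-sided comparison of the kernel with `sin (2πu)`, with constants whose ratio is
controlled by any sufficiently small `r`. -/
theorem exists_sin_bounds {s r : ℝ} (hs : 0 < s) (hr0 : 0 < r) (hr4 : r ≤ Real.exp (-4))
    (hrs : r ≤ Real.exp (-(5 / 4 * (Real.pi * s)))) :
    ∃ M H : ℝ, 0 ≤ M ∧ 8 * r * M < H * (1 - 4 * r) ∧
      (∀ u, |shiftedOddKernel s u| ≤ M * |Real.sin (2 * Real.pi * u)|) ∧
      ∀ x ∈ Set.Ioo (0 : ℝ) (1 / 2), H * Real.sin (2 * Real.pi * x) ≤ shiftedOddKernel s x := by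
  have hr : r ≤ 1 / 54 := by
    refine hr4.trans ?_
    rw [Real.exp_neg, ← one_div]
    refine one_div_le_one_div_of_le (by norm_num) ?_
    have : Real.exp 4 = Real.exp 1 ^ 4 := by rw [← Real.exp_nat_mul]; norm_num
    rw [this]
    calc (54 : ℝ) ≤ 2.7182818283 ^ 4 := by norm_num
      _ ≤ _ := by gcongr; exact Real.exp_one_gt_d9.le
  rcases le_total s 3 with hs3 | hs3
  · set c := 2 * Real.exp (-Real.pi / s) / s ^ (3 / 2 : ℝ) with hc
    have hc0 : 0 < c := by positivity
    refine ⟨c * (5 / 4), c * (3 / 4), by positivity, by nlinarith, fun u => ?_, fun x hx => ?_⟩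
    · have h1 := le_of_small hs hs3 u 1 (by simp)
      have h2 := le_of_small hs hs3 u (-1) (by simp)
      simp only [← hc] at h1 h2
      rw [abs_le]
      constructor <;>
        nlinarith [neg_abs_le (Real.sin (2 * Real.pi * u)), le_abs_self (Real.sin (2 * Real.pi * u))]
    · have h1 := le_of_small hs hs3 x 1 (by simp)
      have hsin : 0 ≤ Real.sin (2 * Real.pi * x) :=
        Real.sin_nonneg_of_nonneg_of_le_pi (by have := hx.1; positivity)
          (by nlinarith [hx.2, Real.pi_pos])
      simp only [← hc, abs_of_nonneg hsin] at h1
      linarith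
  · set z := Real.pi * s with hz
    have hz9 : 9 ≤ z := by nlinarith [Real.pi_gt_three]
    refine ⟨2 / 3 * s ^ 2, Real.exp (-(9 / 16 * z)) / 4, by positivity, ?_,
      abs_le_mul_abs_sin_of_large (by linarith), fun x hx => ?_⟩
    · have hsz : s ^ 2 ≤ z ^ 2 / 9 := by
        have : s ≤ z / 3 := by nlinarith [Real.pi_gt_three]
        nlinarith
      set w := 11 / 16 * z with hw
      have hew : (64 / 27) * z ^ 2 < Real.exp w * (9 / 10) := by
        have h6 : (400 : ℝ) ≤ Real.exp 6 := by
          have : Real.exp 6 = Real.exp 1 ^ 6 := by rw [← Real.exp_nat_mul]; norm_num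
          rw [this]
          calc (400 : ℝ) ≤ 2.7182818283 ^ 6 := by norm_num
            _ ≤ _ := by gcongr; exact Real.exp_one_gt_d9.le
        have hq := Real.quadratic_le_exp_of_nonneg (x := w - 6) (by linarith)
        have he : Real.exp w = Real.exp 6 * Real.exp (w - 6) := by
          rw [← Real.exp_add]; ring_nf
        have h7 : 400 * (1 + (w - 6) + (w - 6) ^ 2 / 2) ≤ Real.exp w := by
          rw [he]
          have : 0 ≤ w - 6 := by linarith
          gcongr
        have hzw : z = 16 / 11 * w := by rw [hw]; ring
        rw [hzw]
        nlinarith [sq_nonneg (w - 5)]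
      have hrE : r * Real.exp w ≤ Real.exp (-(9 / 16 * z)) := by
        calc _ ≤ Real.exp (-(5 / 4 * z)) * Real.exp w := by gcongr
          _ = _ := by rw [← Real.exp_add, hw]; ring_nf
      calc 8 * r * (2 / 3 * s ^ 2) ≤ 8 * r * (2 / 3 * (z ^ 2 / 9)) := by gcongr
        _ = r * (64 / 27 * z ^ 2) / 4 := by ring
        _ < r * (Real.exp w * (9 / 10)) / 4 := by gcongr
        _ = (r * Real.exp w) / 4 * (9 / 10) := by ring
        _ ≤ Real.exp (-(9 / 16 * z)) / 4 * (1 - 4 * r) := by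
          gcongr
          linarith
    · rcases le_total x (1 / 4) with h | h
      · exact ge_of_le_quarter hs3 hx.1 h
      · exact ge_of_quarter_le hs3 h hx.2

end shiftedOddKernel

section ThetaSeries

open HurwitzZeta

theorem HurwitzZeta.hasDerivAt_evenKernel {s : ℝ} (hs : 0 < s) (u : ℝ) :
    HasDerivAt (fun a : ℝ => evenKernel (a : UnitAddCircle) s)
      (-(2 * Real.pi * s) * oddKernel (u : UnitAddCircle) s) u := by
  have him : 0 < (Complex.I * ((1 / s : ℝ) : ℂ)).im := by
    rw [Complex.I_mul_im, Complex.ofReal_re]; positivity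
  have h1 := (hasDerivAt_jacobiTheta₂_fst (u : ℂ) him).real_of_complex
  have h2 : HasDerivAt (fun a : ℝ => cosKernel (a : UnitAddCircle) (1 / s))
      (-2 * Real.pi * sinKernel (u : UnitAddCircle) (1 / s)) u := by
    have hj : jacobiTheta₂' u (Complex.I * ((1 / s : ℝ) : ℂ)) =
        ((-2 * Real.pi * sinKernel (u : UnitAddCircle) (1 / s) : ℝ) : ℂ) := by
      push_cast
      rw [← Complex.ofReal_one, ← Complex.ofReal_div, sinKernel_def,
        mul_div_cancel₀ _ (by simp [Real.pi_ne_zero])]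
    simpa only [hj, ← cosKernel_def, Complex.ofReal_re] using h1
  have h3 := h2.const_mul (1 / s ^ (1 / 2 : ℝ))
  simp only [← evenKernel_functional_equation] at h3
  refine h3.congr_deriv ?_
  rw [oddKernel_functional_equation]
  have : s ^ (3 / 2 : ℝ) = s * s ^ (1 / 2 : ℝ) := by
    rw [← Real.rpow_one_add' hs.le (by norm_num)]; norm_num
  rw [this]
  field_simp

theorem HurwitzZeta.abs_evenKernel_le {s : ℝ} (hs : 0 < s) (u : ℝ) :
    |evenKernel (u : UnitAddCircle) s| ≤ evenKernel (0 : UnitAddCircle) s := by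
  have h0 : evenKernel (0 : UnitAddCircle) s = 1 / s ^ (1 / 2 : ℝ) *
      evenKernel (0 : UnitAddCircle) (1 / s) := by
    conv_lhs => rw [evenKernel_functional_equation, ← evenKernel_eq_cosKernel_of_zero]
  have hE := hasSum_int_evenKernel 0 (one_div_pos.mpr hs)
  have h := (hasSum_int_cosKernel u (one_div_pos.mpr hs)).norm_le_of_bounded hE fun n => by
    rw [norm_mul, Complex.norm_real, Real.norm_eq_abs, Real.abs_exp,
      Complex.norm_exp]
    simp
  rw [h0, evenKernel_functional_equation, abs_mul, abs_of_nonneg (by positivity)]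
  refine mul_le_mul_of_nonneg_left ?_ (by positivity)
  simpa using h

/-- The Gaussian weight of the `l`-th row of the lattice. -/
noncomputable def rowWeight (y α : ℝ) (l : ℤ) : ℝ :=
  Real.exp (-Real.pi * (l + (bPoint 0 y).2) ^ 2 * (α * y))

theorem summable_rowWeight {y α : ℝ} (hy : 0 < y) (hα : 0 < α) : Summable (rowWeight y α) :=
  (hasSum_int_evenKernel (bPoint 0 y).2 (mul_pos hα hy)).summable

theorem summable_mul_rowWeight {y α : ℝ} (hy : 0 < y) (hα : 0 < α) :
    Summable fun l : ℤ => (l : ℝ) * rowWeight y α l := by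
  have h1 := (hasSum_int_oddKernel (bPoint 0 y).2 (mul_pos hα hy)).summable
  have h2 := (summable_rowWeight hy hα).mul_left (bPoint 0 y).2
  refine (h1.sub h2).congr fun l => ?_
  rw [rowWeight]
  ring

theorem latticeTheta_bPoint_eq_tsum {y α : ℝ} (hy : 0 < y) (hα : 0 < α) (t : ℝ) :
    latticeTheta t y (bPoint t y) α =
      ∑' l : ℤ, rowWeight y α l * evenKernel ((1 / 2 + t * l : ℝ) : UnitAddCircle) (α / y) := by
  have hs : 0 < α / y := div_pos hα hy
  let f : ℤ × ℤ → ℝ := fun p => rowWeight y α p.1 *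
    Real.exp (-Real.pi * (p.2 + (1 / 2 + t * p.1)) ^ 2 * (α / y))
  have hrow (l : ℤ) : HasSum (fun k => f (l, k))
      (rowWeight y α l * evenKernel ((1 / 2 + t * l : ℝ) : UnitAddCircle) (α / y)) :=
    (hasSum_int_evenKernel (1 / 2 + t * l) hs).mul_left _
  have hf : Summable f := by
    refine (summable_prod_of_nonneg fun p => ?_).mpr ⟨fun l => (hrow l).summable, ?_⟩
    · exact mul_nonneg (Real.exp_pos _).le (Real.exp_pos _).le
    · simp only [(hrow _).tsum_eq]
      refine Summable.of_norm_bounded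
        ((summable_rowWeight hy hα).mul_right (evenKernel (0 : UnitAddCircle) (α / y))) fun l => ?_
      rw [norm_mul, Real.norm_eq_abs, Real.norm_eq_abs, rowWeight, Real.abs_exp]
      exact mul_le_mul_of_nonneg_left (abs_evenKernel_le hs _) (Real.exp_pos _).le
  rw [latticeTheta, ← (Equiv.prodComm ℤ ℤ).tsum_eq]
  have hterm (p : ℤ × ℤ) : Real.exp (-(Real.pi * α / y) *
      (((((Equiv.prodComm ℤ ℤ) p).1 : ℝ) + (bPoint t y).1) ^ 2 +
        2 * t * ((((Equiv.prodComm ℤ ℤ) p).1 : ℝ) + (bPoint t y).1) *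
          ((((Equiv.prodComm ℤ ℤ) p).2 : ℝ) + (bPoint t y).2) +
        (t ^ 2 + y ^ 2) * ((((Equiv.prodComm ℤ ℤ) p).2 : ℝ) + (bPoint t y).2) ^ 2)) = f p := by
    simp only [f, rowWeight, Equiv.prodComm_apply, Prod.fst_swap, Prod.snd_swap, bPoint]
    rw [← Real.exp_add]
    congr 1
    field_simp
    ring
  simp only [hterm]
  rw [hf.tsum_prod' fun l => (hrow l).summable]
  simp only [(hrow _).tsum_eq]

theorem hasDerivAt_latticeTheta_bPoint {y α M : ℝ} (hy : 0 < y) (hα : 0 < α)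
    (hM : ∀ u, |shiftedOddKernel (α / y) u| ≤ M) (x : ℝ) :
    HasDerivAt (fun t => latticeTheta t y (bPoint t y) α)
      (∑' l : ℤ, rowWeight y α l *
        (2 * Real.pi * (α / y) * shiftedOddKernel (α / y) (x * l) * l)) x := by
  have hs : 0 < α / y := div_pos hα hy
  simp only [latticeTheta_bPoint_eq_tsum hy hα]
  refine hasDerivAt_tsum_of_isPreconnected (t := Set.univ) (y₀ := (0 : ℝ))
    (g := fun (l : ℤ) (t : ℝ) =>
      rowWeight y α l * evenKernel ((1 / 2 + t * l : ℝ) : UnitAddCircle) (α / y))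
    (g' := fun (l : ℤ) (t : ℝ) =>
      rowWeight y α l * (2 * Real.pi * (α / y) * shiftedOddKernel (α / y) (t * l) * l))
    (u := fun l : ℤ => |(l : ℝ) * rowWeight y α l| * (2 * Real.pi * (α / y) * M))
    ((summable_mul_rowWeight hy hα).abs.mul_right _) isOpen_univ isPreconnected_univ
    (fun l t _ => ?_) (fun l t _ => ?_) (Set.mem_univ _) ?_ (Set.mem_univ _)
  · have h1 : HasDerivAt (fun t : ℝ => 1 / 2 + t * l) (l : ℝ) t := by
      simpa using ((hasDerivAt_id t).mul_const (l : ℝ)).const_add (1 / 2)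
    have h2 := ((hasDerivAt_evenKernel hs (1 / 2 + t * l)).comp t h1).const_mul (rowWeight y α l)
    refine h2.congr_deriv ?_
    simp only [shiftedOddKernel]
    ring
  · have hc : 0 < 2 * Real.pi * (α / y) := by positivity
    have e : rowWeight y α l * (2 * Real.pi * (α / y) * shiftedOddKernel (α / y) (t * l) * l) =
        (l * rowWeight y α l) * (2 * Real.pi * (α / y) * shiftedOddKernel (α / y) (t * l)) := by
      ring
    simp only [Real.norm_eq_abs]
    rw [e, abs_mul, abs_mul (2 * Real.pi * (α / y)), abs_of_pos hc]
    gcongr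
    exact hM _
  · simpa using (summable_rowWeight hy hα).mul_right _

theorem rowWeight_neg_le {y α : ℝ} (hyα : 0 ≤ α * y) (m : ℕ) :
    rowWeight y α (-(m + 2 : ℕ)) ≤ rowWeight y α (-1) *
      Real.exp (-(Real.pi * (α * y) * (3 - 2 * (bPoint 0 y).2))) ^ (m + 1) := by
  rw [rowWeight, rowWeight, ← Real.exp_nat_mul, ← Real.exp_add]
  apply Real.exp_le_exp.mpr
  push_cast
  have : 0 ≤ Real.pi * (α * y) * ((m : ℝ) * (m + 1)) := by positivity
  nlinarith

theorem rowWeight_le_neg {y α : ℝ} (hb : 0 ≤ (bPoint 0 y).2) (hyα : 0 ≤ α * y) (n : ℕ) :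
    rowWeight y α n ≤ rowWeight y α (-n) := by
  rw [rowWeight, rowWeight]
  apply Real.exp_le_exp.mpr
  push_cast
  have : 0 ≤ Real.pi * (α * y) * (n * (bPoint 0 y).2) := by positivity
  nlinarith

end ThetaSeries

/-- For every `α ≥ 1`, `y ≥ 1/√2`, `x ∈ (0,1/2)`, the `x`-derivative of
`x ↦ θ_{x,y}(b(x,y);α)` is strictly positive. -/
theorem theta_x_deriv_pos (α : ℝ) (hα : 1 ≤ α) (y : ℝ) (hy : 1 / Real.sqrt 2 ≤ y)
    (x : ℝ) (hx : x ∈ Set.Ioo (0 : ℝ) (1 / 2)) :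
    0 < deriv (fun t => latticeTheta t y (bPoint t y) α) x := by
  have hy0 : 0 < y := lt_of_lt_of_le (by positivity) hy
  have hα0 : 0 < α := by linarith
  have hy2 : 1 / 2 ≤ y ^ 2 := by
    calc (1 / 2 : ℝ) = (1 / Real.sqrt 2) ^ 2 := by
          rw [div_pow, Real.sq_sqrt (by norm_num)]; norm_num
      _ ≤ y ^ 2 := by gcongr
  have hs : 0 < α / y := div_pos hα0 hy0
  have hyα : 0 < α * y := mul_pos hα0 hy0
  have hb : (bPoint 0 y).2 = 1 / 2 - 1 / (8 * y ^ 2) := by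
    simp only [bPoint]; field_simp; ring
  have hb0 : 0 ≤ (bPoint 0 y).2 := by
    rw [hb, sub_nonneg]
    exact one_div_le_one_div_of_le (by norm_num) (by linarith)
  set r := Real.exp (-(Real.pi * (α * y) * (3 - 2 * (bPoint 0 y).2))) with hr
  have hr0 : 0 < r := Real.exp_pos _
  have hexp : α * y * (3 - 2 * (bPoint 0 y).2) = 2 * (α * y) + α / y / 4 := by
    rw [hb]; field_simp; ring
  have hsy : α / y ≤ 2 * (α * y) := by
    rw [div_le_iff₀ hy0]; nlinarith
  have hr4 : r ≤ Real.exp (-4) := by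
    apply Real.exp_le_exp.mpr
    have h7 : 7 / 10 ≤ y := by nlinarith
    have : 7 / 10 ≤ α * y := by nlinarith
    have : 4 / 3 ≤ α * y * (3 - 2 * (bPoint 0 y).2) := by rw [hexp]; linarith
    nlinarith [Real.pi_gt_three]
  have hrs : r ≤ Real.exp (-(5 / 4 * (Real.pi * (α / y)))) := by
    apply Real.exp_le_exp.mpr
    rw [mul_assoc, hexp]
    nlinarith [Real.pi_pos]
  obtain ⟨M, H, hM0, hMH, hup, hlow⟩ := shiftedOddKernel.exists_sin_bounds hs hr0 hr4 hrs
  have hM : ∀ u, |shiftedOddKernel (α / y) u| ≤ M := fun u =>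
    (hup u).trans (mul_le_of_le_one_right hM0 (Real.abs_sin_le_one _))
  rw [(hasDerivAt_latticeTheta_bPoint hy0 hα0 hM x).deriv]
  set G := shiftedOddKernel (α / y) with hG
  have hr4' : 4 * r < 1 := by
    have : Real.exp (-4) < 1 / 4 := by
      rw [Real.exp_neg, ← one_div]
      exact one_div_lt_one_div_of_lt (by norm_num)
        (by linarith [Real.add_one_lt_exp (by norm_num : (4 : ℝ) ≠ 0)])
    linarith
  have hsin : 0 < Real.sin (2 * Real.pi * x) :=
    Real.sin_pos_of_pos_of_lt_pi (by have := hx.1; positivity) (by nlinarith [hx.2, Real.pi_pos])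
  have hsum : Summable fun l : ℤ => (l : ℝ) * rowWeight y α l * G (x * l) :=
    Summable.of_norm_bounded ((summable_mul_rowWeight hy0 hα0).abs.mul_right M) fun l => by
      rw [norm_mul, Real.norm_eq_abs, Real.norm_eq_abs]
      exact mul_le_mul_of_nonneg_left (hM _) (abs_nonneg _)
  have heq : (∑' l : ℤ, rowWeight y α l * (2 * Real.pi * (α / y) * G (x * l) * l)) =
      2 * Real.pi * (α / y) * ∑' l : ℤ, (l : ℝ) * rowWeight y α l * G (x * l) := by
    rw [← tsum_mul_left]
    exact tsum_congr fun l => by ring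
  rw [heq]
  refine mul_pos (by positivity) ?_
  set W := rowWeight y α (-1) with hW
  have hW0 : 0 < W := Real.exp_pos _
  have hlow1 : W * (H * Real.sin (2 * Real.pi * x)) ≤
      rowWeight y α 1 * G x + W * G x := by
    have hc : 0 < 1 - 4 * r := by linarith
    have hH0 : 0 ≤ H := by
      by_contra! h
      have : 0 ≤ 8 * r * M := by positivity
      nlinarith
    have hx1 := hlow x hx
    have hGx : 0 ≤ G x := (mul_nonneg hH0 hsin.le).trans hx1
    have hw1 : 0 ≤ rowWeight y α 1 := (Real.exp_pos _).le
    have := mul_le_mul_of_nonneg_left hx1 hW0.le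
    have := mul_nonneg hw1 hGx
    linarith
  have key := (hsum.hasSum.nat_add_neg).sum_sub_geometric_le 2
    (C := 2 * W * M * Real.sin (2 * Real.pi * x)) (ρ := 4 * r) (by positivity) hr4' fun m => ?_
  · simp only [Finset.sum_range_succ, Finset.sum_range_zero] at key
    push_cast at key
    simp only [mul_one, mul_neg, hG, shiftedOddKernel.neg_right] at key
    simp only [← hG, ← hW] at key
    have hlt : 2 * W * M * Real.sin (2 * Real.pi * x) * (4 * r) / (1 - 4 * r) <
        W * (H * Real.sin (2 * Real.pi * x)) := by
      rw [div_lt_iff₀ (by linarith)]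
      have := mul_lt_mul_of_pos_left hMH (mul_pos hW0 hsin)
      linarith
    norm_num at key
    linarith
  refine (abs_le.mp ?_).1
  have hn0 : (0 : ℝ) ≤ ((m + 2 : ℕ) : ℝ) := Nat.cast_nonneg _
  have hw1 := rowWeight_neg_le hyα.le m
  have hw2 := rowWeight_le_neg hb0 hyα.le (m + 2)
  rw [← hr, ← hW] at hw1
  have hwn : 0 ≤ rowWeight y α ((m + 2 : ℕ) : ℤ) := (Real.exp_pos _).le
  have hwp : 0 ≤ rowWeight y α (-((m + 2 : ℕ) : ℤ)) := (Real.exp_pos _).le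
  have hGn : |G (x * (m + 2 : ℕ))| ≤ M * (((m + 2 : ℕ) : ℝ) * Real.sin (2 * Real.pi * x)) := by
    refine (hup _).trans (mul_le_mul_of_nonneg_left ?_ hM0)
    have := abs_sin_nat_mul_le (m + 2) (2 * Real.pi * x)
    rw [abs_of_pos hsin] at this
    have e : 2 * Real.pi * (x * (m + 2 : ℕ)) = (m + 2 : ℕ) * (2 * Real.pi * x) := by ring
    rwa [e]
  have hsq : ((m + 2 : ℕ) : ℝ) ^ 2 ≤ 4 ^ (m + 1) := by
    have := sq_succ_le_four_pow (m + 1)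
    push_cast at this ⊢
    linarith
  have hcomb : ((((m + 2 : ℕ) : ℤ) : ℝ)) * rowWeight y α ((m + 2 : ℕ) : ℤ) *
        G (x * (((m + 2 : ℕ) : ℤ) : ℝ)) +
      ((-((m + 2 : ℕ) : ℤ) : ℤ) : ℝ) * rowWeight y α (-((m + 2 : ℕ) : ℤ)) *
        G (x * ((-((m + 2 : ℕ) : ℤ) : ℤ) : ℝ)) =
      ((m + 2 : ℕ) : ℝ) * (rowWeight y α ((m + 2 : ℕ) : ℤ) +
        rowWeight y α (-((m + 2 : ℕ) : ℤ))) * G (x * (m + 2 : ℕ)) := by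
    rw [Int.cast_neg, Int.cast_natCast, mul_neg, hG, shiftedOddKernel.neg_right]
    ring
  rw [hcomb, abs_mul, abs_mul, abs_of_nonneg hn0, abs_of_nonneg (add_nonneg hwn hwp)]
  calc _ ≤ ((m + 2 : ℕ) : ℝ) * (W * r ^ (m + 1) + W * r ^ (m + 1)) *
        (M * (((m + 2 : ℕ) : ℝ) * Real.sin (2 * Real.pi * x))) := by
        gcongr
        exact hw2.trans hw1
    _ = 2 * W * M * Real.sin (2 * Real.pi * x) * (((m + 2 : ℕ) : ℝ) ^ 2 * r ^ (m + 1)) := by ring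
    _ ≤ 2 * W * M * Real.sin (2 * Real.pi * x) * (4 ^ (m + 1) * r ^ (m + 1)) := by gcongr
    _ = _ := by rw [mul_pow]
end

section
/- For every fixed α ≥ 1, every y ≥ 1/√2, and every x ∈ (0,1/2), the partial derivative with respect to x of the function x ↦ θ̂_{x,y}(b(x,y);α) (with y and α held fixed, and with the shift b(x,y) varying with x) is strictly positive. -/
/-- The charged (dual) lattice theta function `θ̂_{x,y}(z;α)`. -/
noncomputable def latticeThetaHat (x y : ℝ) (z : ℝ × ℝ) (α : ℝ) : ℝ :=
  ∑' p : ℤ × ℤ,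
    Real.exp (-(Real.pi * α / y) *
      ((p.1 : ℝ) ^ 2 + 2 * x * (p.1 : ℝ) * (p.2 : ℝ) + (x ^ 2 + y ^ 2) * (p.2 : ℝ) ^ 2)) *
    Real.cos (2 * Real.pi * ((p.1 : ℝ) * z.2 - (p.2 : ℝ) * z.1))

/-- The Fourier side of the one-dimensional shifted Gaussian series. -/
noncomputable def cosSeries (a b s : ℝ) : ℝ :=
  ∑' n : ℤ, Real.exp (-(Real.pi * a * (n - b) ^ 2)) * Real.cos (2 * Real.pi * n * s)

/-- Up to the factor `-2π`, the derivative of `cosSeries a b`. -/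
noncomputable def sinSeries (a b s : ℝ) : ℝ :=
  ∑' n : ℤ, (n : ℝ) * Real.exp (-(Real.pi * a * (n - b) ^ 2)) * Real.sin (2 * Real.pi * n * s)

/-- The second moment of the shifted Gaussian weights on `ℤ`. -/
noncomputable def gaussMoment (a b : ℝ) : ℝ :=
  ∑' n : ℤ, (n : ℝ) ^ 2 * Real.exp (-(Real.pi * a * (n - b) ^ 2))

/-- The periodization of a modulated Gaussian. -/
noncomputable def waveSeries (c b s : ℝ) : ℝ :=
  ∑' k : ℤ, Real.exp (-(Real.pi * c * (k + s) ^ 2)) * Real.cos (2 * Real.pi * b * (k + s))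

/-- Up to the factor `-2π`, the derivative of a modulated Gaussian. -/
noncomputable def waveKernel (c b u : ℝ) : ℝ :=
  Real.exp (-(Real.pi * c * u ^ 2)) *
    (c * u * Real.cos (2 * Real.pi * b * u) + b * Real.sin (2 * Real.pi * b * u))

lemma summable_abs_pow_mul_gauss {a : ℝ} (ha : 0 < a) (b : ℝ) (j : ℕ) :
    Summable fun n : ℤ => |(n : ℝ)| ^ j * Real.exp (-(Real.pi * a * (n - b) ^ 2)) := by
  refine Summable.of_nonneg_of_le (fun n => by positivity) (fun n => ?_)
    (summable_pow_mul_jacobiTheta₂_term_bound (a * |b|) ha j)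
  push_cast
  gcongr
  have h : (n : ℝ) * b ≤ |b| * |(n : ℝ)| := by
    rw [mul_comm |b|, ← abs_mul]; exact le_abs_self _
  have hpa : 0 < Real.pi * a := by positivity
  nlinarith [mul_le_mul_of_nonneg_left h hpa.le, mul_nonneg hpa.le (sq_nonneg b)]

lemma summable_gauss {a : ℝ} (ha : 0 < a) (b : ℝ) :
    Summable fun n : ℤ => Real.exp (-(Real.pi * a * (n - b) ^ 2)) := by
  simpa using summable_abs_pow_mul_gauss ha b 0

lemma summable_sq_mul_gauss {a : ℝ} (ha : 0 < a) (b : ℝ) :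
    Summable fun n : ℤ => (n : ℝ) ^ 2 * Real.exp (-(Real.pi * a * (n - b) ^ 2)) := by
  simpa using summable_abs_pow_mul_gauss ha b 2

lemma summable_cosSeries {a : ℝ} (ha : 0 < a) (b s : ℝ) :
    Summable fun n : ℤ =>
      Real.exp (-(Real.pi * a * (n - b) ^ 2)) * Real.cos (2 * Real.pi * n * s) := by
  refine Summable.of_norm_bounded (summable_gauss ha b) fun n => ?_
  rw [norm_mul, Real.norm_eq_abs, Real.norm_eq_abs, Real.abs_exp]
  exact mul_le_of_le_one_right (Real.exp_pos _).le (Real.abs_cos_le_one _)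

lemma norm_sinSeries_term_le (a b s : ℝ) (n : ℤ) :
    ‖(n : ℝ) * Real.exp (-(Real.pi * a * (n - b) ^ 2)) * Real.sin (2 * Real.pi * n * s)‖ ≤
      |(n : ℝ)| ^ 1 * Real.exp (-(Real.pi * a * (n - b) ^ 2)) := by
  rw [norm_mul, norm_mul, Real.norm_eq_abs, Real.norm_eq_abs, Real.norm_eq_abs, Real.abs_exp,
    pow_one]
  exact mul_le_of_le_one_right (by positivity) (Real.abs_sin_le_one _)

lemma summable_sinSeries {a : ℝ} (ha : 0 < a) (b s : ℝ) :
    Summable fun n : ℤ => (n : ℝ) * Real.exp (-(Real.pi * a * (n - b) ^ 2)) *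
      Real.sin (2 * Real.pi * n * s) :=
  Summable.of_norm_bounded (summable_abs_pow_mul_gauss ha b 1) (norm_sinSeries_term_le a b s)

lemma hasDerivAt_cosSeries {a : ℝ} (ha : 0 < a) (b s : ℝ) :
    HasDerivAt (cosSeries a b) (-(2 * Real.pi) * sinSeries a b s) s := by
  unfold sinSeries
  rw [← tsum_mul_left]
  refine hasDerivAt_tsum (y₀ := 0)
    (g := fun (n : ℤ) s => Real.exp (-(Real.pi * a * (n - b) ^ 2)) * Real.cos (2 * Real.pi * n * s))
    (g' := fun (n : ℤ) s => -(2 * Real.pi) * ((n : ℝ) * Real.exp (-(Real.pi * a * (n - b) ^ 2)) *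
      Real.sin (2 * Real.pi * n * s)))
    ((summable_abs_pow_mul_gauss ha b 1).mul_left (2 * Real.pi))
    (fun n y => ?_) (fun n y => ?_) (summable_cosSeries ha b 0) s
  · have h := (((hasDerivAt_id y).const_mul (2 * Real.pi * n)).cos).const_mul
      (Real.exp (-(Real.pi * a * (n - b) ^ 2)))
    refine h.congr_deriv ?_
    simp only [id]
    ring
  · rw [norm_mul, norm_neg, Real.norm_of_nonneg (by positivity : 0 ≤ 2 * Real.pi)]
    exact mul_le_mul_of_nonneg_left (norm_sinSeries_term_le a b y n) (by positivity)

lemma summable_waveSeries {c : ℝ} (hc : 0 < c) (b s : ℝ) :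
    Summable fun k : ℤ =>
      Real.exp (-(Real.pi * c * (k + s) ^ 2)) * Real.cos (2 * Real.pi * b * (k + s)) := by
  refine Summable.of_norm_bounded (summable_gauss hc (-s)) fun k => ?_
  rw [norm_mul, Real.norm_eq_abs, Real.norm_eq_abs, Real.abs_exp, sub_neg_eq_add]
  exact mul_le_of_le_one_right (Real.exp_pos _).le (Real.abs_cos_le_one _)

lemma hasDerivAt_modulatedGauss (c b k u : ℝ) :
    HasDerivAt (fun s => Real.exp (-(Real.pi * c * (k + s) ^ 2)) *
      Real.cos (2 * Real.pi * b * (k + s))) (-(2 * Real.pi) * waveKernel c b (k + u)) u := by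
  have h0 : HasDerivAt (fun s : ℝ => k + s) 1 u := (hasDerivAt_id u).const_add k
  have h1 := ((h0.pow 2).const_mul (Real.pi * c)).neg.exp
  have h2 := (h0.const_mul (2 * Real.pi * b)).cos
  refine (h1.mul h2).congr_deriv ?_
  simp only [waveKernel, Pi.pow_apply, Pi.neg_apply]
  ring

lemma abs_waveKernel_le {c : ℝ} (hc : 0 < c) (b u : ℝ) :
    |waveKernel c b u| ≤ Real.exp (-(Real.pi * c * u ^ 2)) * (c * |u| + |b|) := by
  unfold waveKernel
  rw [abs_mul, Real.abs_exp]
  gcongr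
  refine (abs_add_le _ _).trans ?_
  rw [abs_mul, abs_mul, abs_mul, abs_of_pos hc]
  exact add_le_add (mul_le_of_le_one_right (by positivity) (Real.abs_cos_le_one _))
    (mul_le_of_le_one_right (by positivity) (Real.abs_sin_le_one _))

lemma abs_waveKernel_add_le {c : ℝ} (hc : 0 < c) (b : ℝ) (k : ℤ) {s : ℝ}
    (hs : s ∈ Set.Ioo (-1 : ℝ) 1) :
    |waveKernel c b (k + s)| ≤
      Real.exp (Real.pi * c) * (c * (|(k : ℝ)| ^ 1 * Real.exp (-(Real.pi * (c / 2) * (k - 0) ^ 2)))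
        + (c + |b|) * Real.exp (-(Real.pi * (c / 2) * (k - 0) ^ 2))) := by
  refine (abs_waveKernel_le hc b _).trans ?_
  have hs1 : |s| ≤ 1 := abs_le.2 ⟨hs.1.le, hs.2.le⟩
  have hs2 : s ^ 2 ≤ 1 := by rw [← sq_abs]; nlinarith [abs_nonneg s]
  have h1 : Real.exp (-(Real.pi * c * (k + s) ^ 2)) ≤
      Real.exp (Real.pi * c) * Real.exp (-(Real.pi * (c / 2) * ((k : ℝ) - 0) ^ 2)) := by
    rw [← Real.exp_add]
    gcongr
    have hpc : 0 < Real.pi * c := by positivity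
    have h : (k : ℝ) ^ 2 / 2 - 1 ≤ (k + s) ^ 2 := by nlinarith [sq_nonneg ((k : ℝ) + 2 * s)]
    nlinarith [mul_le_mul_of_nonneg_left h hpc.le]
  have h2 : c * |(k : ℝ) + s| + |b| ≤ c * |(k : ℝ)| + (c + |b|) := by
    have := abs_add_le (k : ℝ) s
    nlinarith
  refine (mul_le_mul h1 h2 (by positivity) (by positivity)).trans (le_of_eq ?_)
  ring

lemma summable_waveKernel_bound {c : ℝ} (hc : 0 < c) (b : ℝ) :
    Summable fun k : ℤ => Real.exp (Real.pi * c) *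
      (c * (|(k : ℝ)| ^ 1 * Real.exp (-(Real.pi * (c / 2) * (k - 0) ^ 2)))
        + (c + |b|) * Real.exp (-(Real.pi * (c / 2) * (k - 0) ^ 2))) :=
  (((summable_abs_pow_mul_gauss (half_pos hc) 0 1).mul_left c).add
    ((summable_gauss (half_pos hc) 0).mul_left _)).mul_left _

lemma summable_waveKernel {c : ℝ} (hc : 0 < c) (b : ℝ) {s : ℝ} (hs : s ∈ Set.Ioo (-1 : ℝ) 1) :
    Summable fun k : ℤ => waveKernel c b (k + s) :=
  Summable.of_norm_bounded (summable_waveKernel_bound hc b) fun k =>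
    abs_waveKernel_add_le hc b k hs

lemma hasDerivAt_waveSeries {c : ℝ} (hc : 0 < c) (b : ℝ) {s : ℝ}
    (hs : s ∈ Set.Ioo (-1 : ℝ) 1) :
    HasDerivAt (waveSeries c b) (-(2 * Real.pi) * ∑' k : ℤ, waveKernel c b (k + s)) s := by
  rw [← tsum_mul_left]
  refine hasDerivAt_tsum_of_isPreconnected
    ((summable_waveKernel_bound hc b).mul_left (2 * Real.pi)) isOpen_Ioo
    isPreconnected_Ioo (fun k y _ => hasDerivAt_modulatedGauss c b k y) (fun k y hy => ?_) hs
    (summable_waveSeries hc b s) hs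
  rw [norm_mul, norm_neg, Real.norm_of_nonneg (by positivity : 0 ≤ 2 * Real.pi)]
  exact mul_le_mul_of_nonneg_left (abs_waveKernel_add_le hc b k hy) (by positivity)

lemma cosSeries_eq_waveSeries {a : ℝ} (ha : 0 < a) (b s : ℝ) :
    cosSeries a b s = Real.sqrt a⁻¹ * waveSeries a⁻¹ b s := by
  have hac : (a : ℂ) ≠ 0 := by exact_mod_cast ha.ne'
  have key := Complex.tsum_exp_neg_quadratic (a := (a : ℂ)) (by simpa using ha)
    ((a * b : ℝ) + Complex.I * s)
  have hL : ∀ n : ℤ, Complex.exp (-Real.pi * a * n ^ 2 +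
      2 * Real.pi * ((a * b : ℝ) + Complex.I * s) * n) =
      (Real.exp (Real.pi * a * b ^ 2) : ℂ) * (Real.exp (-(Real.pi * a * (n - b) ^ 2)) *
        Complex.exp ((2 * Real.pi * n * s : ℝ) * Complex.I)) := by
    intro n
    push_cast
    rw [← Complex.exp_add, ← Complex.exp_add]
    congr 1
    ring
  have hR : ∀ n : ℤ, Complex.exp (-Real.pi / a * (n + Complex.I * ((a * b : ℝ) +
      Complex.I * s)) ^ 2) =
      (Real.exp (Real.pi * a * b ^ 2) : ℂ) * (Real.exp (-(Real.pi * a⁻¹ * (-n + s) ^ 2)) *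
        Complex.exp ((2 * Real.pi * b * (-n + s) : ℝ) * Complex.I)) := by
    intro n
    push_cast
    rw [← Complex.exp_add, ← Complex.exp_add]
    congr 1
    field_simp
    linear_combination (-(a : ℂ) ^ 2 * b ^ 2 - 2 * a * b * s * Complex.I -
      (Complex.I ^ 2 - 1) * s ^ 2 - 2 * n * s) * Complex.I_sq
  simp_rw [hL, hR, tsum_mul_left] at key
  have hE : (Real.exp (Real.pi * a * b ^ 2) : ℂ) ≠ 0 := by exact_mod_cast (Real.exp_pos _).ne'
  rw [mul_left_comm] at key
  replace key := mul_left_cancel₀ hE key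
  have hsq : (1 : ℂ) / (a : ℂ) ^ (1 / 2 : ℂ) = (Real.sqrt a⁻¹ : ℝ) := by
    rw [Real.sqrt_inv, Real.sqrt_eq_rpow, Complex.ofReal_inv, Complex.ofReal_cpow ha.le, one_div]
    push_cast
    rfl
  have hre : ∀ r x : ℝ, ((r : ℂ) * Complex.exp (x * Complex.I)).re = r * Real.cos x := by
    intro r x
    rw [Complex.re_ofReal_mul, Complex.exp_ofReal_mul_I_re]
  have hnorm : ∀ r x : ℝ, ‖(r : ℂ) * Complex.exp (x * Complex.I)‖ = |r| := by
    intro r x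
    rw [norm_mul, Complex.norm_exp_ofReal_mul_I, mul_one, Complex.norm_real, Real.norm_eq_abs]
  have hs1 : Summable fun n : ℤ => ((Real.exp (-(Real.pi * a * (n - b) ^ 2)) : ℝ) : ℂ) *
      Complex.exp ((2 * Real.pi * n * s : ℝ) * Complex.I) := by
    refine Summable.of_norm_bounded (summable_gauss ha b) fun n => ?_
    rw [hnorm, Real.abs_exp]
  have hs2 : Summable fun n : ℤ => ((Real.exp (-(Real.pi * a⁻¹ * (-n + s) ^ 2)) : ℝ) : ℂ) *
      Complex.exp ((2 * Real.pi * b * (-n + s) : ℝ) * Complex.I) := by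
    refine Summable.of_norm_bounded (summable_gauss (inv_pos.2 ha) s) fun n => ?_
    rw [hnorm, Real.abs_exp]
    apply le_of_eq
    ring_nf
  replace key := congrArg Complex.re key
  rw [hsq, Complex.re_ofReal_mul, Complex.re_tsum hs1, Complex.re_tsum hs2] at key
  simp_rw [hre] at key
  unfold cosSeries waveSeries
  rw [key, ← (Equiv.neg ℤ).tsum_eq (fun k : ℤ => Real.exp (-(Real.pi * a⁻¹ * (k + s) ^ 2)) *
    Real.cos (2 * Real.pi * b * (k + s)))]
  simp

lemma sinSeries_eq_tsum_waveKernel {a : ℝ} (ha : 0 < a) (b : ℝ) {s : ℝ}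
    (hs : s ∈ Set.Ioo (-1 : ℝ) 1) :
    sinSeries a b s = Real.sqrt a⁻¹ * ∑' k : ℤ, waveKernel a⁻¹ b (k + s) := by
  have h1 := hasDerivAt_cosSeries ha b s
  rw [funext (cosSeries_eq_waveSeries ha b)] at h1
  have h2 := h1.unique ((hasDerivAt_waveSeries (inv_pos.2 ha) b hs).const_mul (Real.sqrt a⁻¹))
  refine mul_left_cancel₀ (by simp [Real.pi_ne_zero] : -(2 * Real.pi) ≠ 0) ?_
  rw [h2]
  ring

lemma summable_of_abs_le_geometric {f : ℕ → ℝ} {C r : ℝ} (hr0 : 0 ≤ r) (hr1 : r < 1)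
    (h : ∀ n, |f n| ≤ C * r ^ n) : Summable f :=
  Summable.of_norm_bounded ((summable_geometric_of_lt_one hr0 hr1).mul_left C) h

lemma abs_tsum_le_geometric {f : ℕ → ℝ} {C r : ℝ} (hr0 : 0 ≤ r) (hr1 : r < 1)
    (h : ∀ n, |f n| ≤ C * r ^ n) : |∑' n, f n| ≤ C / (1 - r) := by
  rw [div_eq_mul_inv]
  exact tsum_of_norm_bounded (E := ℝ) ((hasSum_geometric_of_lt_one hr0 hr1).mul_left C) h

lemma tsum_int_eq_zero_add_tsum_nat {f : ℤ → ℝ} (hf : Summable f) :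
    ∑' n : ℤ, f n = f 0 + ∑' m : ℕ, (f (m + 1) + f (-(m + 1))) := by
  have h : Summable fun m : ℕ => f m := hf.comp_injective Nat.cast_injective
  have h1 : Summable fun m : ℕ => f (m + 1) := by
    simpa using (summable_nat_add_iff 1).2 h
  have h2 : Summable fun m : ℕ => f (-(m + 1)) :=
    hf.comp_injective fun m n hmn => by simpa using hmn
  rw [tsum_of_nat_of_neg_add_one h h2, h.tsum_eq_zero_add, h1.tsum_add h2]
  push_cast
  ring

lemma abs_sin_int_mul_le (n : ℤ) (x : ℝ) : |Real.sin (n * x)| ≤ |(n : ℝ)| * |Real.sin x| := by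
  have hnat : ∀ m : ℕ, |Real.sin (m * x)| ≤ m * |Real.sin x| := by
    intro m
    induction m with
    | zero => simp
    | succ m ih =>
      push_cast
      rw [add_mul, one_mul, Real.sin_add]
      refine (abs_add_le _ _).trans ?_
      rw [abs_mul, abs_mul]
      nlinarith [mul_le_of_le_one_right (abs_nonneg (Real.sin (m * x))) (Real.abs_cos_le_one x),
        mul_le_of_le_one_left (abs_nonneg (Real.sin x)) (Real.abs_cos_le_one (m * x))]
  obtain ⟨m, rfl | rfl⟩ := n.eq_nat_or_neg
  · simpa using hnat m
  · simpa using hnat m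

lemma abs_sinSeries_int_mul_le {a : ℝ} (ha : 0 < a) (b : ℝ) (l : ℤ) (s : ℝ) :
    |sinSeries a b (l * s)| ≤ |(l : ℝ)| * (gaussMoment a b * |Real.sin (2 * Real.pi * s)|) := by
  rw [← Real.norm_eq_abs, sinSeries]
  refine (tsum_of_norm_bounded (((summable_sq_mul_gauss ha b).hasSum.mul_right
    (|(l : ℝ)| * |Real.sin (2 * Real.pi * s)|))) fun n => ?_).trans (le_of_eq ?_)
  · rw [norm_mul, norm_mul, Real.norm_eq_abs, Real.norm_eq_abs, Real.norm_eq_abs, Real.abs_exp,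
      ← sq_abs (n : ℝ), show 2 * Real.pi * n * (l * s) = (n * l : ℤ) * (2 * Real.pi * s) by
        push_cast; ring]
    have h := abs_sin_int_mul_le (n * l) (2 * Real.pi * s)
    push_cast at h ⊢
    rw [abs_mul] at h
    calc _ ≤ |(n : ℝ)| * Real.exp (-(Real.pi * a * (n - b) ^ 2)) *
          (|(n : ℝ)| * |(l : ℝ)| * |Real.sin (2 * Real.pi * s)|) := by gcongr
      _ = _ := by ring
  · unfold gaussMoment
    ring

lemma abs_sinSeries_le {a : ℝ} (ha : 0 < a) (b s : ℝ) :
    |sinSeries a b s| ≤ ∑' n : ℤ, |(n : ℝ)| ^ 1 * Real.exp (-(Real.pi * a * (n - b) ^ 2)) :=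
  tsum_of_norm_bounded (summable_abs_pow_mul_gauss ha b 1).hasSum (norm_sinSeries_term_le a b s)

lemma sinSeries_neg (a b s : ℝ) : sinSeries a b (-s) = -sinSeries a b s := by
  unfold sinSeries
  rw [← tsum_neg]
  congr 1 with n
  rw [mul_neg, Real.sin_neg]
  ring

/-- The `cos` factor in the theta function evaluated at the special shift. -/
lemma cos_bPoint {y : ℝ} (hy : 0 < y) (t : ℝ) (k l : ℤ) :
    Real.cos (2 * Real.pi * ((k : ℝ) * (bPoint t y).2 - (l : ℝ) * (bPoint t y).1)) =
      (-1) ^ l * Real.cos (2 * Real.pi * (bPoint t y).2 * (k + l * t)) := by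
  rw [mul_comm, ← Real.cos_sub_int_mul_pi]
  congr 1
  simp only [bPoint]
  field_simp
  ring

lemma summable_latticeThetaHat {y α : ℝ} (hy : 0 < y) (hα : 0 < α) (t : ℝ) (z : ℝ × ℝ) :
    Summable fun p : ℤ × ℤ => Real.exp (-(Real.pi * α / y) *
      ((p.1 : ℝ) ^ 2 + 2 * t * (p.1 : ℝ) * (p.2 : ℝ) + (t ^ 2 + y ^ 2) * (p.2 : ℝ) ^ 2)) *
      Real.cos (2 * Real.pi * ((p.1 : ℝ) * z.2 - (p.2 : ℝ) * z.1)) := by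
  set D : ℝ := 2 * (1 + (t ^ 2 + 1) / y ^ 2) with hD
  have hDpos : 0 < D := by positivity
  have hd : 0 < α / y / D := by positivity
  have h0 := summable_gauss hd 0
  refine Summable.of_norm_bounded (h0.mul_of_nonneg h0 (fun _ => by positivity)
    (fun _ => by positivity)) fun p => ?_
  rw [norm_mul, Real.norm_eq_abs, Real.norm_eq_abs, Real.abs_exp, ← Real.exp_add]
  refine (mul_le_of_le_one_right (Real.exp_pos _).le (Real.abs_cos_le_one _)).trans ?_
  gcongr
  generalize (p.1 : ℝ) = k
  generalize (p.2 : ℝ) = l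
  have hq : k ^ 2 + l ^ 2 ≤ D * ((k + t * l) ^ 2 + y ^ 2 * l ^ 2) := by
    have e : D * (y ^ 2 * l ^ 2) = 2 * (y ^ 2 + t ^ 2 + 1) * l ^ 2 := by
      rw [hD]; field_simp; ring
    have e2 : 2 * (k + t * l) ^ 2 ≤ D * (k + t * l) ^ 2 := by
      have : 2 ≤ D := by
        have : 0 ≤ (t ^ 2 + 1) / y ^ 2 := by positivity
        linarith
      gcongr
    nlinarith [sq_nonneg (k + 2 * t * l), sq_nonneg l,
      mul_nonneg (sq_nonneg y) (sq_nonneg l), mul_nonneg (sq_nonneg t) (sq_nonneg l)]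
  have hpos : 0 ≤ Real.pi * (α / y / D) := by positivity
  have := mul_le_mul_of_nonneg_left hq hpos
  have e : Real.pi * (α / y / D) * (D * ((k + t * l) ^ 2 + y ^ 2 * l ^ 2)) =
      (Real.pi * α / y) * (k ^ 2 + 2 * t * k * l + (t ^ 2 + y ^ 2) * l ^ 2) := by
    field_simp; ring
  rw [e] at this
  linarith

lemma latticeThetaHat_bPoint_eq {y α : ℝ} (hy : 0 < y) (hα : 0 < α) (t : ℝ) :
    latticeThetaHat t y (bPoint t y) α = Real.sqrt (y / α) *
      ∑' l : ℤ, (-1) ^ l * Real.exp (-(Real.pi * (α * y) * (l - 0) ^ 2)) *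
        cosSeries (y / α) (bPoint t y).2 (l * t) := by
  have hs := summable_latticeThetaHat hy hα t (bPoint t y)
  unfold latticeThetaHat
  rw [← (Equiv.prodComm ℤ ℤ).tsum_eq]
  refine (((Equiv.prodComm ℤ ℤ).summable_iff.2 hs).tsum_prod).trans ?_
  rw [← tsum_mul_left]
  congr 1 with l
  simp only [Function.comp_apply, Equiv.prodComm_apply, Prod.swap]
  rw [cosSeries_eq_waveSeries (by positivity), inv_div, waveSeries, ← tsum_mul_left,
    ← tsum_mul_left, ← tsum_mul_left]
  have hsq : Real.sqrt (y / α) * Real.sqrt (α / y) = 1 := by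
    rw [← Real.sqrt_mul (by positivity)]
    field_simp
    simp
  congr 1 with k
  rw [cos_bPoint hy]
  have he : Real.exp (-(Real.pi * α / y) *
      ((k : ℝ) ^ 2 + 2 * t * k * l + (t ^ 2 + y ^ 2) * (l : ℝ) ^ 2)) =
      Real.exp (-(Real.pi * (α * y) * (l - 0) ^ 2)) *
        Real.exp (-(Real.pi * (α / y) * (k + l * t) ^ 2)) := by
    rw [← Real.exp_add]
    congr 1
    field_simp
    ring
  rw [he]
  linear_combination (-((-1 : ℝ) ^ l * Real.exp (-(Real.pi * (α * y) * (l - 0) ^ 2)) *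
        Real.exp (-(Real.pi * (α / y) * (k + l * t) ^ 2)) *
          Real.cos (2 * Real.pi * (bPoint t y).2 * (k + l * t)))) * hsq

lemma hasDerivAt_latticeThetaHat_bPoint {y α : ℝ} (hy : 0 < y) (hα : 0 < α) (t : ℝ) :
    HasDerivAt (fun t => latticeThetaHat t y (bPoint t y) α) (-(2 * Real.pi) * Real.sqrt (y / α) *
      ∑' l : ℤ, (-1) ^ l * l * Real.exp (-(Real.pi * (α * y) * (l - 0) ^ 2)) *
        sinSeries (y / α) (bPoint t y).2 (l * t)) t := by
  have ha : 0 < y / α := by positivity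
  have hay : 0 < α * y := by positivity
  rw [funext (latticeThetaHat_bPoint_eq hy hα), mul_comm (-(2 * Real.pi)), mul_assoc,
    ← tsum_mul_left]
  refine HasDerivAt.const_mul _ ?_
  set b := (bPoint t y).2 with hb
  have hb' : ∀ u, (bPoint u y).2 = b := fun u => rfl
  simp only [hb']
  refine hasDerivAt_tsum (y₀ := 0)
    (g := fun (l : ℤ) t => (-1) ^ l * Real.exp (-(Real.pi * (α * y) * (l - 0) ^ 2)) *
        cosSeries (y / α) b (l * t))
    (g' := fun (l : ℤ) t => -(2 * Real.pi) * ((-1) ^ l * l *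
        Real.exp (-(Real.pi * (α * y) * (l - 0) ^ 2)) * sinSeries (y / α) b (l * t)))
    (((summable_abs_pow_mul_gauss hay 0 1).mul_right
      (∑' n : ℤ, |(n : ℝ)| ^ 1 * Real.exp (-(Real.pi * (y / α) * (n - b) ^ 2)))).mul_left
      (2 * Real.pi)) (fun l u => ?_) (fun l u => ?_) ?_ t
  · have h := ((hasDerivAt_cosSeries ha b (l * u)).comp u
      ((hasDerivAt_id u).const_mul (l : ℝ))).const_mul
      ((-1) ^ l * Real.exp (-(Real.pi * (α * y) * (l - 0) ^ 2)))
    refine h.congr_deriv ?_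
    ring
  · rw [norm_mul, norm_neg, Real.norm_of_nonneg (by positivity : 0 ≤ 2 * Real.pi), norm_mul,
      norm_mul, norm_mul, norm_zpow, norm_neg, norm_one, one_zpow, one_mul, Real.norm_eq_abs,
      Real.norm_eq_abs, Real.norm_eq_abs, Real.abs_exp, pow_one]
    gcongr
    exact abs_sinSeries_le ha b _
  · refine Summable.of_norm_bounded ((summable_gauss hay 0).mul_right |cosSeries (y / α) b 0|)
      fun l => ?_
    rw [norm_mul, norm_mul, norm_zpow, norm_neg, norm_one, one_zpow, one_mul, mul_zero,
      Real.norm_eq_abs, Real.norm_eq_abs, Real.abs_exp]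

/-- The alternating series is negative as soon as its terms `l = ±1` dominate the others. -/
lemma alternating_tsum_neg {a b c t : ℝ} (ha : 0 < a) (hc : 0 < c)
    (hw : Real.exp (-(Real.pi * c)) ≤ 3 / 20)
    (hdom : 5 * Real.exp (-(Real.pi * c)) ^ 3 * (gaussMoment a b * |Real.sin (2 * Real.pi * t)|) <
      sinSeries a b t) :
    ∑' l : ℤ, (-1) ^ l * l * Real.exp (-(Real.pi * c * (l - 0) ^ 2)) *
      sinSeries a b (l * t) < 0 := by
  set w := Real.exp (-(Real.pi * c)) with hw_def
  have hw0 : 0 < w := Real.exp_pos _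
  set B := gaussMoment a b * |Real.sin (2 * Real.pi * t)| with hB
  have hB0 : 0 ≤ B := by
    have : 0 ≤ gaussMoment a b := tsum_nonneg fun n => by positivity
    positivity
  have hsum : Summable fun l : ℤ => (-1) ^ l * l * Real.exp (-(Real.pi * c * (l - 0) ^ 2)) *
      sinSeries a b (l * t) := by
    refine Summable.of_norm_bounded ((summable_abs_pow_mul_gauss hc 0 2).mul_right B) fun l => ?_
    rw [norm_mul, norm_mul, norm_mul, norm_zpow, norm_neg, norm_one, one_zpow, one_mul,
      Real.norm_eq_abs, Real.norm_eq_abs, Real.norm_eq_abs, Real.abs_exp]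
    calc _ ≤ |(l : ℝ)| * Real.exp (-(Real.pi * c * (l - 0) ^ 2)) * (|(l : ℝ)| * B) := by
          gcongr
          exact abs_sinSeries_int_mul_le ha b l t
      _ = _ := by ring
  rw [tsum_int_eq_zero_add_tsum_nat hsum]
  have hterm : ∀ m : ℕ, (-1) ^ ((m : ℤ) + 1) * (((m : ℤ) + 1 : ℤ) : ℝ) *
        Real.exp (-(Real.pi * c * ((((m : ℤ) + 1 : ℤ) : ℝ) - 0) ^ 2)) *
        sinSeries a b ((((m : ℤ) + 1 : ℤ) : ℝ) * t) +
      (-1) ^ (-((m : ℤ) + 1)) * ((-((m : ℤ) + 1) : ℤ) : ℝ) *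
        Real.exp (-(Real.pi * c * (((-((m : ℤ) + 1) : ℤ) : ℝ) - 0) ^ 2)) *
        sinSeries a b (((-((m : ℤ) + 1) : ℤ) : ℝ) * t) =
      2 * ((-1) ^ (m + 1) * ((m : ℝ) + 1) * w ^ ((m + 1) ^ 2) *
        sinSeries a b (((m : ℝ) + 1) * t)) := by
    intro m
    have e : Real.exp (-(Real.pi * c * (((m : ℝ) + 1) - 0) ^ 2)) = w ^ ((m + 1) ^ 2) := by
      rw [hw_def, ← Real.exp_nat_mul]
      congr 1
      push_cast
      ring
    have e' : Real.exp (-(Real.pi * c * (-((m : ℝ) + 1) - 0) ^ 2)) = w ^ ((m + 1) ^ 2) := by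
      rw [← e]
      congr 1
      ring
    have z : (-1 : ℝ) ^ ((m : ℤ) + 1) = (-1) ^ (m + 1) := by
      rw [← zpow_natCast]; push_cast; rfl
    have z' : (-1 : ℝ) ^ (-((m : ℤ) + 1)) = (-1) ^ (m + 1) := by
      rw [zpow_neg, z, ← inv_pow]; norm_num
    push_cast
    rw [e, e', z, z', neg_mul ((m : ℝ) + 1) t, sinSeries_neg]
    ring
  simp_rw [hterm, tsum_mul_left]
  set g : ℕ → ℝ := fun m => (-1) ^ (m + 1) * ((m : ℝ) + 1) * w ^ ((m + 1) ^ 2) *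
    sinSeries a b (((m : ℝ) + 1) * t) with hg
  have htail : ∀ m : ℕ, |g (m + 1)| ≤ 4 * w ^ 4 * B * (4 * w ^ 4) ^ m := by
    intro m
    have h1 := abs_sinSeries_int_mul_le ha b (m + 2 : ℕ) t
    have h2 : w ^ ((m + 2) ^ 2) ≤ w ^ (4 + 4 * m) :=
      pow_le_pow_of_le_one hw0.le (by linarith) (by nlinarith)
    have h3 : ((m : ℝ) + 2) ^ 2 ≤ 4 * 4 ^ m := by
      have : ∀ m : ℕ, ((m : ℝ) + 2) ^ 2 ≤ 4 * 4 ^ m := by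
        intro m
        induction m with
        | zero => norm_num
        | succ m ih =>
          push_cast
          rw [pow_succ (4 : ℝ)]
          nlinarith [(Nat.cast_nonneg m : (0 : ℝ) ≤ m)]
      exact this m
    have hm : |((m : ℝ) + 2)| = (m : ℝ) + 2 := abs_of_nonneg (by positivity)
    push_cast at h1
    rw [hm] at h1
    simp only [hg]
    push_cast
    rw [show (m : ℝ) + 1 + 1 = m + 2 by ring, show m + 1 + 1 = m + 2 from rfl, abs_mul, abs_mul,
      abs_mul, abs_pow, abs_neg, abs_one, one_pow, one_mul, hm,
      abs_of_pos (by positivity : 0 < w ^ ((m + 2) ^ 2))]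
    calc _ ≤ ((m : ℝ) + 2) * w ^ (4 + 4 * m) * (((m : ℝ) + 2) * B) := by gcongr
      _ = ((m : ℝ) + 2) ^ 2 * (w ^ (4 + 4 * m) * B) := by ring
      _ ≤ 4 * 4 ^ m * (w ^ (4 + 4 * m) * B) := by gcongr
      _ = _ := by rw [pow_add, pow_mul, mul_pow]; ring
  have hw4 : w ^ 4 ≤ (3 / 20) ^ 4 := by gcongr
  have hr1 : 4 * w ^ 4 < 1 := by norm_num at hw4; linarith
  have hgs : Summable g :=
    (summable_nat_add_iff 1).1 (summable_of_abs_le_geometric (by positivity) hr1 htail)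
  have hb := abs_tsum_le_geometric (by positivity) hr1 htail
  rw [hgs.tsum_eq_zero_add]
  have hb2 : 4 * w ^ 4 * B / (1 - 4 * w ^ 4) ≤ 5 * w ^ 4 * B := by
    rw [div_le_iff₀ (by linarith)]
    have : 0 ≤ w ^ 4 * B := by positivity
    norm_num at hw4
    nlinarith
  have h0 : g 0 = -(w * sinSeries a b t) := by simp [hg]
  have hfin := mul_lt_mul_of_pos_left hdom hw0
  have := (le_abs_self _).trans (hb.trans hb2)
  rw [h0]
  simp only [Int.cast_zero, mul_zero, zero_mul, zero_add]
  nlinarith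

lemma exp_neg_pi_div_two_le : Real.exp (-(Real.pi / 2)) ≤ 21 / 100 := by
  have h : Real.exp (-(Real.pi / 2)) ^ 2 ≤ (21 / 100) ^ 2 := by
    rw [← Real.exp_nat_mul, show ((2 : ℕ) : ℝ) * -(Real.pi / 2) = -Real.pi by push_cast; ring,
      Real.exp_neg]
    have h1 : (22.8 : ℝ) ≤ Real.exp Real.pi := by
      calc (22.8 : ℝ) ≤ 2.718 ^ 3 * (0.14 + 1) := by norm_num
        _ ≤ Real.exp 1 ^ 3 * Real.exp 0.14 := by
          gcongr
          · linarith [Real.exp_one_gt_d9]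
          · exact Real.add_one_le_exp _
        _ = Real.exp 3.14 := by
          rw [← Real.exp_nat_mul, ← Real.exp_add]; norm_num
        _ ≤ Real.exp Real.pi := Real.exp_le_exp.2 Real.pi_gt_d2.le
    calc (Real.exp Real.pi)⁻¹ ≤ (22.8 : ℝ)⁻¹ := by gcongr
      _ ≤ _ := by norm_num
  exact le_of_sq_le_sq h (by norm_num)

/-- Decay of the symmetrized Gaussian weights. -/
lemma symm_gauss_decay {a b : ℝ} (ha : 1 / 4 ≤ a) (hb0 : 0 ≤ b) (hb1 : b ≤ 1 / 2) (m : ℕ) :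
    ((m : ℝ) + 2) ^ 2 * (Real.exp (-(Real.pi * a * ((m : ℝ) + 2 - b) ^ 2)) +
      Real.exp (-(Real.pi * a * ((m : ℝ) + 2 + b) ^ 2))) ≤
    84 / 100 * (Real.exp (-(Real.pi * a * (1 - b) ^ 2)) +
      Real.exp (-(Real.pi * a * (1 + b) ^ 2))) * (1 / 10) ^ m := by
  set q := Real.exp (-(Real.pi / 2)) with hq
  have hq0 : 0 < q := Real.exp_pos _
  have hq1 : q ≤ 21 / 100 := exp_neg_pi_div_two_le
  have hm : (0 : ℝ) ≤ m := Nat.cast_nonneg m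
  have hmm : (m : ℝ) ≤ m ^ 2 := by exact_mod_cast Nat.le_self_pow two_ne_zero m
  have key : ∀ x z : ℝ, 2 + 4 * m ≤ x ^ 2 - z ^ 2 →
      Real.exp (-(Real.pi * a * x ^ 2)) ≤ q ^ (1 + 2 * m) * Real.exp (-(Real.pi * a * z ^ 2)) := by
    intro x z h
    rw [hq, ← Real.exp_nat_mul, ← Real.exp_add]
    gcongr
    have h1 : 1 / 4 * (2 + 4 * (m : ℝ)) ≤ a * (x ^ 2 - z ^ 2) := by gcongr
    have h2 := mul_le_mul_of_nonneg_left h1 Real.pi_pos.le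
    push_cast
    nlinarith
  have h1 := key (m + 2 - b) (1 - b) (by nlinarith)
  have h2 := key (m + 2 + b) (1 + b) (by nlinarith)
  have h3 : ((m : ℝ) + 2) ^ 2 ≤ 4 * (9 / 4) ^ m := by
    have : ∀ m : ℕ, ((m : ℝ) + 2) ^ 2 ≤ 4 * (9 / 4) ^ m := by
      intro m
      induction m with
      | zero => norm_num
      | succ m ih =>
        push_cast
        rw [pow_succ (9 / 4 : ℝ)]
        nlinarith [(Nat.cast_nonneg m : (0 : ℝ) ≤ m)]
    exact this m
  have hqq : 9 / 4 * q ^ 2 ≤ 1 / 10 := by nlinarith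
  set C := Real.exp (-(Real.pi * a * (1 - b) ^ 2)) + Real.exp (-(Real.pi * a * (1 + b) ^ 2))
  have hC : 0 ≤ C := by positivity
  calc _ ≤ 4 * (9 / 4) ^ m * (q ^ (1 + 2 * m) * C) := by
        gcongr
        rw [mul_add]
        exact add_le_add h1 h2
    _ = 4 * q * C * (9 / 4 * q ^ 2) ^ m := by rw [pow_add, pow_mul, mul_pow]; ring
    _ ≤ 84 / 100 * C * (1 / 10) ^ m := by gcongr; linarith

lemma gaussMoment_pos {a : ℝ} (ha : 0 < a) (b : ℝ) : 0 < gaussMoment a b :=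
  (summable_sq_mul_gauss ha b).tsum_pos (fun n => by positivity) 1 (by simp [Real.exp_pos])

lemma gaussMoment_mul_sin_le_of_quarter_le {a b s : ℝ} (ha : 1 / 4 ≤ a) (hb0 : 0 ≤ b)
    (hb1 : b ≤ 1 / 2) (hs : s ∈ Set.Ioo (0 : ℝ) (1 / 2)) :
    gaussMoment a b * Real.sin (2 * Real.pi * s) ≤ 33 * sinSeries a b s := by
  have ha0 : 0 < a := by linarith
  have hsin : 0 < Real.sin (2 * Real.pi * s) :=
    Real.sin_pos_of_pos_of_lt_pi (by have := hs.1; positivity) (by nlinarith [hs.2, Real.pi_pos])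
  set σ := Real.sin (2 * Real.pi * s) with hσ
  set d : ℝ → ℝ := fun x => Real.exp (-(Real.pi * a * (x - b) ^ 2)) +
    Real.exp (-(Real.pi * a * (x + b) ^ 2)) with hd
  have hd0 : ∀ x, 0 < d x := fun x => by positivity
  have hdecay : ∀ m : ℕ, ((m : ℝ) + 2) ^ 2 * d (m + 2) ≤ 84 / 100 * d 1 * (1 / 10) ^ m :=
    symm_gauss_decay ha hb0 hb1
  have hneg : ∀ x : ℝ, Real.exp (-(Real.pi * a * (-x - b) ^ 2)) =
      Real.exp (-(Real.pi * a * (x + b) ^ 2)) := by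
    intro x; congr 1; ring
  have hM : gaussMoment a b = ∑' m : ℕ, ((m : ℝ) + 1) ^ 2 * d (m + 1) := by
    rw [gaussMoment, tsum_int_eq_zero_add_tsum_nat (summable_sq_mul_gauss ha0 b)]
    simp only [Int.cast_zero, ne_eq, OfNat.ofNat_ne_zero, not_false_eq_true, zero_pow, zero_mul,
      zero_add]
    congr 1 with m
    push_cast
    rw [hneg, hd]
    ring
  have hS : sinSeries a b s =
      ∑' m : ℕ, ((m : ℝ) + 1) * d (m + 1) * Real.sin (2 * Real.pi * (m + 1) * s) := by
    rw [sinSeries, tsum_int_eq_zero_add_tsum_nat (summable_sinSeries ha0 b s)]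
    simp only [Int.cast_zero, zero_mul, zero_add]
    congr 1 with m
    push_cast
    rw [hneg, hd, show 2 * Real.pi * -((m : ℝ) + 1) * s = -(2 * Real.pi * (m + 1) * s) by ring,
      Real.sin_neg]
    ring
  have hMt : ∀ m : ℕ, |(((m + 1 : ℕ) : ℝ) + 1) ^ 2 * d ((m + 1 : ℕ) + 1)| ≤
      84 / 100 * d 1 * (1 / 10) ^ m := by
    intro m
    rw [abs_of_nonneg (mul_nonneg (by positivity) (hd0 _).le)]
    push_cast
    rw [show (m : ℝ) + 1 + 1 = m + 2 by ring]
    exact hdecay m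
  have hSt : ∀ m : ℕ, |(((m + 1 : ℕ) : ℝ) + 1) * d ((m + 1 : ℕ) + 1) *
      Real.sin (2 * Real.pi * ((m + 1 : ℕ) + 1) * s)| ≤ 84 / 100 * d 1 * σ * (1 / 10) ^ m := by
    intro m
    have h := abs_sin_int_mul_le ((m : ℤ) + 2) (2 * Real.pi * s)
    rw [← hσ, abs_of_pos hsin] at h
    push_cast at h ⊢
    rw [abs_of_pos (by positivity : 0 < (m : ℝ) + 2)] at h
    rw [show (m : ℝ) + 1 + 1 = m + 2 by ring, abs_mul,
      abs_of_pos (mul_pos (by positivity) (hd0 _)),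
      show 2 * Real.pi * ((m : ℝ) + 2) * s = (m + 2) * (2 * Real.pi * s) by ring]
    have hd' := (hd0 (m + 2)).le
    calc _ ≤ ((m : ℝ) + 2) * d (m + 2) * ((m + 2) * σ) := by gcongr
      _ = ((m : ℝ) + 2) ^ 2 * d (m + 2) * σ := by ring
      _ ≤ 84 / 100 * d 1 * (1 / 10) ^ m * σ := mul_le_mul_of_nonneg_right (hdecay m) hsin.le
      _ = _ := by ring
  have alg : ∀ TM TS D τ : ℝ, TM ≤ 84 / 100 * D / (1 - 1 / 10) →
      -(84 / 100 * D * τ / (1 - 1 / 10)) ≤ TS → 0 < D → 0 < τ →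
      (D + TM) * τ ≤ 33 * (D * τ + TS) := by
    intro TM TS D τ h1 h2 hD hτ
    have h3 := mul_le_mul_of_nonneg_right h1 hτ.le
    have h4 : 0 < D * τ := by positivity
    ring_nf at h2 h3 ⊢
    linarith
  have hr0 : (0 : ℝ) ≤ 1 / 10 := by norm_num
  have hr1 : (1 / 10 : ℝ) < 1 := by norm_num
  have hMsum := (summable_nat_add_iff (f := fun m : ℕ =>
    ((m : ℝ) + 1) ^ 2 * d (m + 1)) 1).1
    (summable_of_abs_le_geometric hr0 hr1 hMt)
  have hSsum := (summable_nat_add_iff (f := fun m : ℕ =>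
    ((m : ℝ) + 1) * d (m + 1) * Real.sin (2 * Real.pi * (m + 1) * s)) 1).1
    (summable_of_abs_le_geometric hr0 hr1 hSt)
  have hMb := (abs_le.1 (abs_tsum_le_geometric hr0 hr1 hMt)).2
  have hSb := (abs_le.1 (abs_tsum_le_geometric hr0 hr1 hSt)).1
  rw [hM, hS, hMsum.tsum_eq_zero_add, hSsum.tsum_eq_zero_add]
  simp only [Nat.cast_zero, zero_add, one_pow, one_mul, mul_one]
  rw [← hσ]
  exact alg _ _ _ _ hMb hSb (hd0 1) hsin

lemma gaussMoment_le {a b : ℝ} (ha : 0 < a) (hb0 : 0 ≤ b) (hb1 : b ≤ 1 / 2) :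
    gaussMoment a b ≤ 11 * a⁻¹ ^ 2 := by
  have hpi := Real.pi_gt_three
  have hζ := hasSum_zeta_two
  have hle : ∀ x z : ℝ, 0 < x → x / 2 ≤ |z| →
      x ^ 2 * Real.exp (-(Real.pi * a * z ^ 2)) ≤ 32 / (Real.pi ^ 2 * a ^ 2) * (1 / x ^ 2) := by
    intro x z hx hz
    have hz2 : x ^ 2 / 4 ≤ z ^ 2 := by
      rw [← sq_abs z]; nlinarith
    set v := Real.pi * a * (x ^ 2 / 4) with hv
    have hv0 : 0 < v := by positivity
    have h1 : Real.exp (-(Real.pi * a * z ^ 2)) ≤ Real.exp (-v) := by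
      gcongr
      rw [hv]
      gcongr
    have h2 : Real.exp (-v) ≤ 2 / v ^ 2 := by
      rw [Real.exp_neg, inv_le_comm₀ (Real.exp_pos _) (by positivity), inv_div]
      have := Real.quadratic_le_exp_of_nonneg hv0.le
      linarith
    calc _ ≤ x ^ 2 * (2 / v ^ 2) := by gcongr; exact h1.trans h2
      _ = _ := by rw [hv]; field_simp; norm_num
  rw [gaussMoment, tsum_int_eq_zero_add_tsum_nat (summable_sq_mul_gauss ha b)]
  simp only [Int.cast_zero, ne_eq, OfNat.ofNat_ne_zero, not_false_eq_true, zero_pow, zero_mul,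
    zero_add]
  have hζ1 : HasSum (fun m : ℕ => 1 / ((m : ℝ) + 1) ^ 2) (Real.pi ^ 2 / 6) := by
    have := (hasSum_nat_add_iff' 1).2 hζ
    simpa using this
  have hζ2 := hζ1.mul_left (2 * (32 / (Real.pi ^ 2 * a ^ 2)))
  have hb := tsum_of_norm_bounded (E := ℝ) (f := fun m : ℕ =>
    ((((m : ℤ) + 1 : ℤ) : ℝ)) ^ 2 *
      Real.exp (-(Real.pi * a * (((((m : ℤ) + 1 : ℤ) : ℝ)) - b) ^ 2)) +
    (((-((m : ℤ) + 1) : ℤ) : ℝ)) ^ 2 *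
      Real.exp (-(Real.pi * a * ((((-((m : ℤ) + 1) : ℤ) : ℝ)) - b) ^ 2))) hζ2 (fun m => by
    rw [Real.norm_of_nonneg (by positivity)]
    push_cast
    have hm : (0 : ℝ) ≤ m := Nat.cast_nonneg m
    have h1 := hle (m + 1) (m + 1 - b) (by positivity) (le_trans (by linarith) (le_abs_self _))
    have h2 := hle (m + 1) (-(m + 1) - b) (by positivity) (le_trans (by linarith) (neg_le_abs _))
    rw [neg_sq]
    linarith)
  refine (le_abs_self _).trans (hb.trans ?_)
  rw [inv_pow, ← div_eq_mul_inv]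
  rw [show 2 * (32 / (Real.pi ^ 2 * a ^ 2)) * (Real.pi ^ 2 / 6) = (32 / 3) / a ^ 2 by
    field_simp; norm_num]
  gcongr
  norm_num

lemma waveKernel_neg (c b u : ℝ) : waveKernel c b (-u) = -waveKernel c b u := by
  simp only [waveKernel, neg_sq, mul_neg, Real.cos_neg, Real.sin_neg]
  ring

/-- The derivative of `waveKernel c b`. -/
noncomputable def waveKernelDeriv (c b u : ℝ) : ℝ :=
  Real.exp (-(Real.pi * c * u ^ 2)) *
    (-(2 * Real.pi * c * u) *
        (c * u * Real.cos (2 * Real.pi * b * u) + b * Real.sin (2 * Real.pi * b * u)) +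
      (c * Real.cos (2 * Real.pi * b * u) - c * u * (2 * Real.pi * b) * Real.sin (2 * Real.pi * b * u)
        + b * (2 * Real.pi * b) * Real.cos (2 * Real.pi * b * u)))

lemma hasDerivAt_waveKernel (c b u : ℝ) :
    HasDerivAt (waveKernel c b) (waveKernelDeriv c b u) u := by
  have h0 := hasDerivAt_id u
  have h1 := ((h0.pow 2).const_mul (Real.pi * c)).neg.exp
  have h2 := (h0.const_mul (2 * Real.pi * b)).cos
  have h3 := (h0.const_mul (2 * Real.pi * b)).sin
  refine (h1.mul (((h0.const_mul c).mul h2).add (h3.const_mul b))).congr_deriv ?_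
  simp only [waveKernelDeriv, id, Pi.pow_apply, Pi.neg_apply, Pi.mul_apply, Pi.add_apply]
  ring

lemma abs_waveKernelDeriv_le {c b u₀ u : ℝ} (hc : 4 ≤ c) (hb0 : 0 ≤ b) (hb1 : b ≤ 1 / 2)
    (hu₀ : 3 / 4 ≤ u₀) (hu : u₀ ≤ u) :
    |waveKernelDeriv c b u| ≤ 8 * c * Real.exp (-(2.6 * c * u₀ ^ 2)) := by
  have hpi := Real.pi_gt_d2
  have hpi' := Real.pi_lt_d2
  have hu' : 3 / 4 ≤ u := hu₀.trans hu
  set C := Real.cos (2 * Real.pi * b * u)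
  set S := Real.sin (2 * Real.pi * b * u)
  have hC : |C| ≤ 1 := Real.abs_cos_le_one _
  have hS : |S| ≤ 1 := Real.abs_sin_le_one _
  have hcu : 3 ≤ c * u := by nlinarith
  have h1 : |c * u * C + b * S| ≤ c * u + b := by
    refine (abs_add_le _ _).trans ?_
    rw [abs_mul, abs_mul b, abs_of_nonneg (by positivity : 0 ≤ c * u), abs_of_nonneg hb0]
    exact add_le_add (mul_le_of_le_one_right (by positivity) hC) (mul_le_of_le_one_right hb0 hS)
  have h2 : |c * C| ≤ c := by
    rw [abs_mul, abs_of_nonneg (by positivity : 0 ≤ c)]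
    exact mul_le_of_le_one_right (by positivity) hC
  have h3 : |c * u * (2 * Real.pi * b) * S| ≤ c * u * (2 * Real.pi * b) := by
    rw [abs_mul, abs_of_nonneg (by positivity : 0 ≤ c * u * (2 * Real.pi * b))]
    exact mul_le_of_le_one_right (by positivity) hS
  have h4 : |b * (2 * Real.pi * b) * C| ≤ b * (2 * Real.pi * b) := by
    rw [abs_mul, abs_of_nonneg (by positivity : 0 ≤ b * (2 * Real.pi * b))]
    exact mul_le_of_le_one_right (by positivity) hC
  have h5 : |-(2 * Real.pi * c * u) * (c * u * C + b * S) +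
      (c * C - c * u * (2 * Real.pi * b) * S + b * (2 * Real.pi * b) * C)| ≤
      (2 * Real.pi * c * u) * (c * u + b) +
      (c + c * u * (2 * Real.pi * b) + b * (2 * Real.pi * b)) := by
    refine (abs_add_le _ _).trans (add_le_add ?_ ?_)
    · rw [abs_mul, abs_neg, abs_of_nonneg (by positivity : 0 ≤ 2 * Real.pi * c * u)]
      gcongr
    · refine (abs_add_le _ _).trans (add_le_add ((abs_sub _ _).trans (add_le_add h2 h3)) h4)
  have h6 : (2 * Real.pi * c * u) * (c * u + b) +
      (c + c * u * (2 * Real.pi * b) + b * (2 * Real.pi * b)) ≤ 10 * c * (c * u ^ 2) := by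
    have e1 : 2 * Real.pi * b ≤ 3.15 := by nlinarith
    have e2 : b * (2 * Real.pi * b) ≤ 1 / 2 * 3.15 := by gcongr
    have e3 : c * u * (2 * Real.pi * b) ≤ c * u * 3.15 := by gcongr
    have e4 : (2 * Real.pi * c * u) * (c * u + b) ≤ 6.3 * (c * u) ^ 2 + c * u * 3.15 := by
      have : 2 * Real.pi * (c * u) ^ 2 ≤ 6.3 * (c * u) ^ 2 := by gcongr; linarith
      nlinarith
    have e5 : c * u * 3 ≤ (c * u) ^ 2 := by nlinarith
    have e6 : c ≤ 4 / 9 * (c * u) ^ 2 := by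
      have : 9 / 16 ≤ u ^ 2 := by nlinarith
      have := mul_le_mul_of_nonneg_left this (by positivity : 0 ≤ c ^ 2)
      nlinarith
    nlinarith
  have h7 : c * u ^ 2 ≤ 0.74 * Real.exp (c * u ^ 2 / 2) := by
    have e := Real.add_one_le_exp (c * u ^ 2 / 2 - 1)
    rw [Real.exp_sub, le_div_iff₀ (Real.exp_pos 1)] at e
    have e1 := Real.exp_one_gt_d9
    have e2 : 0 ≤ c * u ^ 2 / 2 := by positivity
    nlinarith
  unfold waveKernelDeriv
  rw [abs_mul, Real.abs_exp]
  calc _ ≤ Real.exp (-(Real.pi * c * u ^ 2)) * (10 * c * (0.74 * Real.exp (c * u ^ 2 / 2))) := by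
        gcongr
        refine h5.trans (h6.trans ?_)
        gcongr
    _ = 7.4 * c * Real.exp (-((Real.pi - 1 / 2) * (c * u ^ 2))) := by
        rw [show -((Real.pi - 1 / 2) * (c * u ^ 2)) = -(Real.pi * c * u ^ 2) + c * u ^ 2 / 2 by ring,
          Real.exp_add]
        ring
    _ ≤ 8 * c * Real.exp (-(2.6 * c * u₀ ^ 2)) := by
        have e : 2.6 * (c * u₀ ^ 2) ≤ (Real.pi - 1 / 2) * (c * u ^ 2) :=
          mul_le_mul (by linarith) (by gcongr) (by positivity) (by linarith)
        refine mul_le_mul (by gcongr; norm_num) (Real.exp_le_exp.2 (by linarith))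
          (Real.exp_pos _).le (by positivity)

lemma abs_waveKernel_sub_le {c b u₀ u v : ℝ} (hc : 4 ≤ c) (hb0 : 0 ≤ b) (hb1 : b ≤ 1 / 2)
    (hu₀ : 3 / 4 ≤ u₀) (hu : u₀ ≤ u) (hv : u₀ ≤ v) :
    |waveKernel c b v - waveKernel c b u| ≤ 8 * c * Real.exp (-(2.6 * c * u₀ ^ 2)) * |v - u| :=
  (convex_Ici u₀).norm_image_sub_le_of_norm_hasDerivWithin_le
    (fun x _ => (hasDerivAt_waveKernel c b x).hasDerivWithinAt)
    (fun _ hx => abs_waveKernelDeriv_le hc hb0 hb1 hu₀ hx) hu hv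

lemma gauss_tail_le_geometric {c u₀ : ℝ} (hc : 4 ≤ c) (hu₀ : 3 / 4 ≤ u₀) (m : ℕ) :
    Real.exp (-(2.6 * c * (m + u₀) ^ 2)) ≤ Real.exp (-(2.6 * c * u₀ ^ 2)) * (1 / 11) ^ m := by
  have h1 : Real.exp (-(2.6 * c)) ≤ 1 / 11 := by
    rw [Real.exp_neg, inv_le_comm₀ (Real.exp_pos _) (by norm_num)]
    have := Real.add_one_le_exp (2.6 * c)
    norm_num at this ⊢
    linarith
  calc _ ≤ Real.exp (-(2.6 * c * u₀ ^ 2)) * Real.exp (-(2.6 * c)) ^ m := by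
        rw [← Real.exp_nat_mul, ← Real.exp_add]
        gcongr
        have hm : (0 : ℝ) ≤ m := Nat.cast_nonneg m
        have : u₀ ^ 2 + m ≤ (m + u₀) ^ 2 := by nlinarith
        nlinarith
    _ ≤ _ := by gcongr

lemma abs_tsum_gauss_tail_le {c u₀ δ : ℝ} (hc : 4 ≤ c) (hu₀ : 3 / 4 ≤ u₀) (hδ : 0 ≤ δ)
    {f : ℕ → ℝ}
    (hf : ∀ m : ℕ, |f m| ≤ 8 * c * Real.exp (-(2.6 * c * (m + u₀) ^ 2)) * δ) :
    |∑' m, f m| ≤ 9 * c * δ * Real.exp (-(2.6 * c * u₀ ^ 2)) := by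
  have h := abs_tsum_le_geometric (f := f) (C := 8 * c * Real.exp (-(2.6 * c * u₀ ^ 2)) * δ)
    (by norm_num : (0 : ℝ) ≤ 1 / 11) (by norm_num) (fun m => (hf m).trans (by
      calc _ ≤ 8 * c * (Real.exp (-(2.6 * c * u₀ ^ 2)) * (1 / 11) ^ m) * δ := by
            gcongr
            exact gauss_tail_le_geometric hc hu₀ m
        _ = _ := by ring))
  refine h.trans ?_
  have : 0 ≤ c * δ * Real.exp (-(2.6 * c * u₀ ^ 2)) := by positivity
  norm_num
  linarith

lemma le_tsum_waveKernel_of_le_quarter {c b s : ℝ} (hc : 4 ≤ c) (hb0 : 0 ≤ b) (hb1 : b ≤ 1 / 2)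
    (hs0 : 0 < s) (hs1 : s ≤ 1 / 4) :
    1 / 200 * Real.exp (-(Real.pi * c / 4)) * Real.sin (2 * Real.pi * s) ≤
      ∑' k : ℤ, waveKernel c b (k + s) := by
  have hpi := Real.pi_gt_d2
  have hpi' := Real.pi_lt_d2
  rw [tsum_int_eq_zero_add_tsum_nat
    (summable_waveKernel (by linarith) b ⟨by linarith, by linarith⟩)]
  have htail := abs_tsum_gauss_tail_le hc le_rfl (by positivity : 0 ≤ 2 * s)
    (f := fun m : ℕ => waveKernel c b (((m : ℤ) + 1 : ℤ) + s) +
      waveKernel c b ((-((m : ℤ) + 1) : ℤ) + s)) (fun m => by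
    push_cast
    have hm : (0 : ℝ) ≤ m := Nat.cast_nonneg m
    have h := abs_waveKernel_sub_le (c := c) (b := b) (u₀ := m + 3 / 4) (u := m + 1 - s)
      (v := m + 1 + s) hc hb0 hb1 (by linarith) (by linarith) (by linarith)
    rw [show (m : ℝ) + 1 + s - (m + 1 - s) = 2 * s by ring,
      abs_of_pos (by positivity : 0 < 2 * s)] at h
    rw [show -((m : ℝ) + 1) + s = -(m + 1 - s) by ring, waveKernel_neg, ← sub_eq_add_neg]
    exact h)
  replace htail := (abs_le.1 htail).1
  have hφ0 : 0 ≤ 2 * Real.pi * b * s := by positivity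
  have hφ1 : 2 * Real.pi * b * s ≤ 0.7875 := by
    have : b * s ≤ 1 / 2 * (1 / 4) := by gcongr
    nlinarith
  have hcos : 0.68 ≤ Real.cos (2 * Real.pi * b * s) := by
    have := Real.one_sub_sq_div_two_le_cos (x := 2 * Real.pi * b * s)
    nlinarith
  have hsin : 0 ≤ Real.sin (2 * Real.pi * b * s) :=
    Real.sin_nonneg_of_nonneg_of_le_pi hφ0 (by linarith)
  have hmain : Real.exp (-(0.2 * c)) * (c * s * 0.68) ≤ waveKernel c b s := by
    unfold waveKernel
    have : 0 ≤ b * Real.sin (2 * Real.pi * b * s) := by positivity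
    have h2 : c * s * 0.68 ≤ c * s * Real.cos (2 * Real.pi * b * s) := by gcongr
    have h3 : Real.exp (-(0.2 * c)) ≤ Real.exp (-(Real.pi * c * s ^ 2)) := by
      have : s ^ 2 ≤ 1 / 16 := by nlinarith
      have : Real.pi * s ^ 2 ≤ 3.15 * (1 / 16) := by gcongr
      exact Real.exp_le_exp.2 (by nlinarith)
    exact mul_le_mul h3 (by linarith) (by positivity) (Real.exp_pos _).le
  have hdecay : Real.exp (-(2.6 * c * (3 / 4) ^ 2)) ≤ 0.01 * Real.exp (-(0.2 * c)) := by
    have h1 : Real.exp (-5) ≤ 0.01 := by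
      rw [Real.exp_neg, inv_le_comm₀ (Real.exp_pos _) (by norm_num)]
      calc (0.01 : ℝ)⁻¹ ≤ 2.7 ^ 5 := by norm_num
        _ ≤ Real.exp 1 ^ 5 := by gcongr; linarith [Real.exp_one_gt_d9]
        _ = Real.exp 5 := by rw [← Real.exp_nat_mul]; norm_num
    calc _ ≤ Real.exp (-5 + -(0.2 * c)) := by
          gcongr
          norm_num
          linarith
      _ = Real.exp (-5) * Real.exp (-(0.2 * c)) := Real.exp_add _ _
      _ ≤ _ := by gcongr
  have hexp : Real.exp (-(Real.pi * c / 4)) ≤ Real.exp (-(0.2 * c)) := by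
    gcongr
    nlinarith
  have hσ : Real.sin (2 * Real.pi * s) ≤ 6.3 * s :=
    (Real.sin_le (by positivity)).trans (by gcongr; linarith)
  have hlhs : 1 / 200 * Real.exp (-(Real.pi * c / 4)) * Real.sin (2 * Real.pi * s) ≤
      1 / 200 * Real.exp (-(0.2 * c)) * (6.3 * s) := by
    have : 0 ≤ Real.sin (2 * Real.pi * s) :=
      Real.sin_nonneg_of_nonneg_of_le_pi (by positivity) (by nlinarith)
    gcongr
  have hcs := mul_le_mul_of_nonneg_left hdecay (by positivity : 0 ≤ 9 * c * (2 * s))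
  have hes : 4 * (s * Real.exp (-(0.2 * c))) ≤ c * (s * Real.exp (-(0.2 * c))) := by gcongr
  have hes0 : 0 < s * Real.exp (-(0.2 * c)) := by positivity
  simp only [Int.cast_zero, zero_add]
  norm_num at *
  nlinarith

lemma le_sub_mul_of_decay {c b v E C C' S S' : ℝ} (hc : 4 ≤ c) (hb : 1 / 4 ≤ b) (hv0 : 0 ≤ v)
    (hv1 : v ≤ 1 / 4) (hE0 : 0 < E) (hE1 : E * (1 + 25 * v) ≤ 1) (hC : 0 ≤ C) (hC' : C' ≤ C)
    (hS : 1 / 4 ≤ S) (hS' : S' - S ≤ 4.5 * v) :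
    0.05 * v ≤ c * (1 / 2 - v) * C + b * S - E * (c * (1 / 2 + v) * C' + b * S') := by
  have hEv : 0 ≤ E * v := by positivity
  have hE2 : E ≤ 1 := by linarith
  have e1 : E * (1 / 2 + v) ≤ 1 / 2 - v := by
    have h1 : 1 / 2 + v ≤ (1 + 25 * v) * (1 / 2 - v) := by nlinarith
    have h2 := mul_le_mul_of_nonneg_left h1 hE0.le
    have h3 := mul_le_mul_of_nonneg_right hE1 (by linarith : 0 ≤ 1 / 2 - v)
    linarith
  have e2 : c * (E * (1 / 2 + v) * C') ≤ c * ((1 / 2 - v) * C) := by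
    refine mul_le_mul_of_nonneg_left ?_ (by linarith)
    exact (mul_le_mul_of_nonneg_left hC' (by positivity)).trans (mul_le_mul_of_nonneg_right e1 hC)
  have e3 : 3.4 * v ≤ 1 - E := by
    have h1 : 0 ≤ (1 - E) * (1 / 4 - v) := mul_nonneg (by linarith) (by linarith)
    linarith
  have e4 : 0.2 * v ≤ S - E * S' := by
    have h1 := mul_le_mul_of_nonneg_left hS' hE0.le
    have h2 := mul_le_mul_of_nonneg_left hS (by linarith : 0 ≤ 1 - E)
    linarith
  have e5 : 1 / 4 * (0.2 * v) ≤ b * (S - E * S') := by gcongr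
  linarith

/-- Near `s = 1/2` the two dominant terms of the periodized kernel do not cancel. -/
lemma le_waveKernel_sub_waveKernel {c b v : ℝ} (hc : 4 ≤ c) (hb0 : 1 / 4 ≤ b) (hb1 : b ≤ 1 / 2)
    (hv0 : 0 ≤ v) (hv1 : v ≤ 1 / 4) :
    0.05 * v * Real.exp (-(Real.pi * c * (1 / 2 - v) ^ 2)) ≤
      waveKernel c b (1 / 2 - v) - waveKernel c b (1 / 2 + v) := by
  have hpi := Real.pi_gt_d2
  have hpi' := Real.pi_lt_d2
  set E := Real.exp (-(2 * Real.pi * c * v)) with hE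
  have hE0 : 0 < E := Real.exp_pos _
  have hE1 : E * (1 + 25 * v) ≤ 1 := by
    have h := Real.add_one_le_exp (2 * Real.pi * c * v)
    have h2 : 25 * v ≤ 2 * Real.pi * c * v := by
      gcongr
      nlinarith
    calc E * (1 + 25 * v) ≤ E * Real.exp (2 * Real.pi * c * v) := by gcongr; linarith
      _ = 1 := by rw [hE, ← Real.exp_add]; simp
  have hE2 : E ≤ 1 := by nlinarith
  have hgauss : Real.exp (-(Real.pi * c * (1 / 2 + v) ^ 2)) =
      Real.exp (-(Real.pi * c * (1 / 2 - v) ^ 2)) * E := by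
    rw [hE, ← Real.exp_add]; congr 1; ring
  have hbs : b * (1 / 2 - v) ≤ 1 / 4 := by nlinarith
  have hbs' : 1 / 16 ≤ b * (1 / 2 - v) := by nlinarith
  have hcos0 : 0 ≤ Real.cos (2 * Real.pi * b * (1 / 2 - v)) :=
    Real.cos_nonneg_of_neg_pi_div_two_le_of_le (by nlinarith) (by nlinarith)
  have hcos : Real.cos (2 * Real.pi * b * (1 / 2 + v)) ≤
      Real.cos (2 * Real.pi * b * (1 / 2 - v)) :=
    Real.cos_le_cos_of_nonneg_of_le_pi (by nlinarith)
      (by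
        have : b * (1 / 2 + v) ≤ 1 / 2 * (3 / 4) := by gcongr; linarith
        nlinarith)
      (by gcongr; linarith)
  have hsin : 1 / 4 ≤ Real.sin (2 * Real.pi * b * (1 / 2 - v)) := by
    refine le_trans ?_ (Real.mul_le_sin (by nlinarith) (by nlinarith))
    rw [show 2 / Real.pi * (2 * Real.pi * b * (1 / 2 - v)) = 4 * (b * (1 / 2 - v)) by
      field_simp; ring]
    linarith
  have hdiff : Real.sin (2 * Real.pi * b * (1 / 2 + v)) -
      Real.sin (2 * Real.pi * b * (1 / 2 - v)) ≤ 4.5 * v := by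
    have e : Real.sin (2 * Real.pi * b * (1 / 2 + v)) - Real.sin (2 * Real.pi * b * (1 / 2 - v)) =
        2 * (Real.sin (2 * Real.pi * b * v) * Real.cos (Real.pi * b)) := by
      rw [Real.sin_sub_sin]
      rw [show (2 * Real.pi * b * (1 / 2 + v) - 2 * Real.pi * b * (1 / 2 - v)) / 2 =
        2 * Real.pi * b * v by ring, show (2 * Real.pi * b * (1 / 2 + v) +
        2 * Real.pi * b * (1 / 2 - v)) / 2 = Real.pi * b by ring]
      ring
    have h1 : Real.sin (2 * Real.pi * b * v) ≤ 3.15 * v := by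
      refine (Real.sin_le (by positivity)).trans ?_
      gcongr
      nlinarith
    have h2 : Real.cos (Real.pi * b) ≤ 0.71 := by
      refine (Real.cos_le_cos_of_nonneg_of_le_pi (x := Real.pi / 4) (by positivity) (by nlinarith)
        (by nlinarith)).trans ?_
      rw [Real.cos_pi_div_four]
      have : Real.sqrt 2 ≤ 1.42 := Real.sqrt_le_iff.2 ⟨by norm_num, by norm_num⟩
      linarith
    have h3 : 0 ≤ Real.cos (Real.pi * b) :=
      Real.cos_nonneg_of_neg_pi_div_two_le_of_le (by nlinarith) (by nlinarith)
    rw [e]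
    have : Real.sin (2 * Real.pi * b * v) * Real.cos (Real.pi * b) ≤ 3.15 * v * 0.71 := by gcongr
    linarith
  have key := le_sub_mul_of_decay hc hb0 hv0 hv1 hE0 hE1 hcos0 hcos hsin hdiff
  unfold waveKernel
  rw [hgauss]
  have := mul_le_mul_of_nonneg_left key (Real.exp_pos (-(Real.pi * c * (1 / 2 - v) ^ 2))).le
  linarith

lemma tsum_int_eq_add_tsum_nat {f : ℤ → ℝ} (hf : Summable f) :
    ∑' n : ℤ, f n = f 0 + f (-1) + ∑' m : ℕ, (f (m + 1) + f (-(m + 2))) := by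
  have h1 : Summable fun m : ℕ => f m := hf.comp_injective Nat.cast_injective
  have h2 : Summable fun m : ℕ => f (-(m + 1)) :=
    hf.comp_injective fun m n hmn => by simpa using hmn
  rw [tsum_of_nat_of_neg_add_one h1 h2, ← h1.tsum_add h2, (h1.add h2).tsum_eq_zero_add]
  congr 2

lemma mul_exp_neg_le_of_four_le {c : ℝ} (hc : 4 ≤ c) :
    c * Real.exp (-(2.6 * c * (5 / 4) ^ 2)) ≤ 0.001 * Real.exp (-(Real.pi * c / 4)) := by
  have hpi' := Real.pi_lt_d2
  have h8 : (1000 : ℝ) ≤ Real.exp (2 * c) := by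
    calc (1000 : ℝ) ≤ 2.7 ^ 8 := by norm_num
      _ ≤ Real.exp 1 ^ 8 := by gcongr; linarith [Real.exp_one_gt_d9]
      _ = Real.exp 8 := by rw [← Real.exp_nat_mul]; norm_num
      _ ≤ Real.exp (2 * c) := Real.exp_le_exp.2 (by linarith)
  have hcexp : c ≤ Real.exp c := by linarith [Real.add_one_le_exp c]
  have h3 : 1000 * c ≤ Real.exp (3 * c) := by
    rw [show 3 * c = 2 * c + c by ring, Real.exp_add]
    gcongr
  have h4 : Real.exp (3 * c) * Real.exp (-(2.6 * c * (5 / 4) ^ 2)) ≤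
      Real.exp (-(Real.pi * c / 4)) := by
    rw [← Real.exp_add]
    refine Real.exp_le_exp.2 ?_
    have : Real.pi * c ≤ 3.15 * c := by gcongr
    norm_num at this ⊢
    linarith
  have h5 := mul_le_mul_of_nonneg_right h3 (Real.exp_pos (-(2.6 * c * (5 / 4) ^ 2))).le
  linarith

lemma le_tsum_waveKernel_of_quarter_le {c b s : ℝ} (hc : 4 ≤ c) (hb0 : 1 / 4 ≤ b)
    (hb1 : b ≤ 1 / 2) (hs0 : 1 / 4 ≤ s) (hs1 : s < 1 / 2) :
    1 / 200 * Real.exp (-(Real.pi * c / 4)) * Real.sin (2 * Real.pi * s) ≤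
      ∑' k : ℤ, waveKernel c b (k + s) := by
  have hpi := Real.pi_gt_d2
  have hpi' := Real.pi_lt_d2
  obtain ⟨v, rfl⟩ : ∃ v, s = 1 / 2 - v := ⟨1 / 2 - s, by ring⟩
  have hv0 : 0 < v := by linarith
  have hv1 : v ≤ 1 / 4 := by linarith
  have hsum := summable_waveKernel (c := c) (by linarith) b (s := 1 / 2 - v)
    ⟨by linarith, by linarith⟩
  rw [tsum_int_eq_add_tsum_nat hsum]
  have htail := abs_tsum_gauss_tail_le hc (u₀ := 5 / 4) (by norm_num)
    (by positivity : 0 ≤ 2 * v)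
    (f := fun m : ℕ => waveKernel c b (((m : ℤ) + 1 : ℤ) + (1 / 2 - v)) +
      waveKernel c b ((-((m : ℤ) + 2) : ℤ) + (1 / 2 - v))) (fun m => by
    push_cast
    have hm : (0 : ℝ) ≤ m := Nat.cast_nonneg m
    have h := abs_waveKernel_sub_le (c := c) (b := b) (u₀ := m + 5 / 4) (u := m + 3 / 2 + v)
      (v := m + 3 / 2 - v) hc (by linarith) hb1 (by linarith) (by linarith) (by linarith)
    rw [show (m : ℝ) + 3 / 2 - v - (m + 3 / 2 + v) = -(2 * v) by ring, abs_neg,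
      abs_of_pos (by positivity : 0 < 2 * v)] at h
    rw [show -((m : ℝ) + 2) + (1 / 2 - v) = -(m + 3 / 2 + v) by ring, waveKernel_neg,
      ← sub_eq_add_neg, show (m : ℝ) + 1 + (1 / 2 - v) = m + 3 / 2 - v by ring]
    exact h)
  replace htail := (abs_le.1 htail).1
  have hmain := le_waveKernel_sub_waveKernel hc hb0 hb1 hv0.le hv1
  have hexp : Real.exp (-(Real.pi * c / 4)) ≤ Real.exp (-(Real.pi * c * (1 / 2 - v) ^ 2)) := by
    refine Real.exp_le_exp.2 (neg_le_neg ?_)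
    have : (1 / 2 - v) ^ 2 ≤ 1 / 4 := by nlinarith
    calc Real.pi * c * (1 / 2 - v) ^ 2 ≤ Real.pi * c * (1 / 4) := by gcongr
      _ = _ := by ring
  have hdecay := mul_exp_neg_le_of_four_le hc
  have hσ : Real.sin (2 * Real.pi * (1 / 2 - v)) ≤ 6.3 * v := by
    rw [show 2 * Real.pi * (1 / 2 - v) = Real.pi - 2 * Real.pi * v by ring, Real.sin_pi_sub]
    exact (Real.sin_le (by positivity)).trans (by gcongr; linarith)
  have hlhs := mul_le_mul_of_nonneg_left hσ
    (by positivity : 0 ≤ 1 / 200 * Real.exp (-(Real.pi * c / 4)))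
  have hcs := mul_le_mul_of_nonneg_left hdecay (by positivity : 0 ≤ 18 * v)
  have hmain' := mul_le_mul_of_nonneg_left hexp (by positivity : 0 ≤ 0.05 * v)
  have hes : 0 < v * Real.exp (-(Real.pi * c / 4)) := by positivity
  have e0 : waveKernel c b ((-1 : ℤ) + (1 / 2 - v)) =
      -waveKernel c b (1 / 2 + v) := by
    rw [← waveKernel_neg]
    congr 1
    push_cast
    ring
  rw [e0]
  simp only [Int.cast_zero, zero_add]
  linarith

lemma le_tsum_waveKernel {c b s : ℝ} (hc : 4 ≤ c) (hb0 : 1 / 4 ≤ b) (hb1 : b ≤ 1 / 2)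
    (hs : s ∈ Set.Ioo (0 : ℝ) (1 / 2)) :
    1 / 200 * Real.exp (-(Real.pi * c / 4)) * Real.sin (2 * Real.pi * s) ≤
      ∑' k : ℤ, waveKernel c b (k + s) := by
  rcases le_total s (1 / 4) with h | h
  · exact le_tsum_waveKernel_of_le_quarter hc (by linarith) hb1 hs.1 h
  · exact le_tsum_waveKernel_of_quarter_le hc hb0 hb1 h hs.2

lemma exp_neg_pi_mul_le {r : ℝ} (hr : 7 / 10 ≤ r) : Real.exp (-(Real.pi * r)) ≤ 3 / 20 := by
  have h : (20 / 3 : ℝ) ≤ Real.exp (Real.pi * r) := by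
    calc (20 / 3 : ℝ) ≤ 2.7 ^ 2 * 1 := by norm_num
      _ ≤ Real.exp 1 ^ 2 * Real.exp 0.1 := by
        gcongr
        · linarith [Real.exp_one_gt_d9]
        · exact Real.one_le_exp (by norm_num)
      _ = Real.exp 2.1 := by rw [← Real.exp_nat_mul, ← Real.exp_add]; norm_num
      _ ≤ Real.exp (Real.pi * r) := Real.exp_le_exp.2 (by nlinarith [Real.pi_gt_three])
  rw [Real.exp_neg]
  exact (inv_anti₀ (by norm_num) h).trans (by norm_num)

lemma mul_sq_mul_exp_lt {c : ℝ} (hc : 4 ≤ c) :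
    55 * c ^ 2 * Real.exp (-(Real.pi * (c / 2))) ^ 3 < 1 / 200 * Real.exp (-(Real.pi * c / 4)) := by
  have hpi := Real.pi_gt_three
  have h1 : c ^ 2 ≤ Real.exp c := by
    have e := Real.add_one_le_exp (c / 2 - 1)
    rw [Real.exp_sub, le_div_iff₀ (Real.exp_pos 1)] at e
    have : c ≤ Real.exp (c / 2) := by nlinarith [Real.exp_one_gt_d9]
    calc c ^ 2 ≤ Real.exp (c / 2) ^ 2 := by gcongr
      _ = Real.exp c := by rw [← Real.exp_nat_mul]; congr 1; push_cast; ring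
  have h2 : (11001 : ℝ) ≤ Real.exp (5 / 2 * c) := by
    calc (11001 : ℝ) ≤ 2.7 ^ 10 := by norm_num
      _ ≤ Real.exp 1 ^ 10 := by gcongr; linarith [Real.exp_one_gt_d9]
      _ = Real.exp 10 := by rw [← Real.exp_nat_mul]; norm_num
      _ ≤ Real.exp (5 / 2 * c) := Real.exp_le_exp.2 (by linarith)
  have h3 : 11001 * c ^ 2 * Real.exp (-(Real.pi * (c / 2))) ^ 3 ≤
      Real.exp (-(Real.pi * c / 4)) := by
    calc _ ≤ Real.exp (5 / 2 * c) * Real.exp c * Real.exp (-(Real.pi * (c / 2))) ^ 3 := by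
          gcongr
      _ = Real.exp (5 / 2 * c + c + 3 * -(Real.pi * (c / 2))) := by
          rw [Real.exp_add, Real.exp_add, ← Real.exp_nat_mul]
          norm_num
      _ ≤ _ := Real.exp_le_exp.2 (by nlinarith)
  have h4 : 0 < c ^ 2 * Real.exp (-(Real.pi * (c / 2))) ^ 3 := by positivity
  linarith

lemma exp_pow_mul_gaussMoment_lt_sinSeries {a b r s : ℝ} (ha : 0 < a) (hr : 7 / 10 ≤ r)
    (har : a⁻¹ / 2 ≤ r) (hb0 : 1 / 4 ≤ b) (hb1 : b ≤ 1 / 2) (hs : s ∈ Set.Ioo (0 : ℝ) (1 / 2)) :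
    5 * Real.exp (-(Real.pi * r)) ^ 3 * (gaussMoment a b * |Real.sin (2 * Real.pi * s)|) <
      sinSeries a b s := by
  have hsin : 0 < Real.sin (2 * Real.pi * s) :=
    Real.sin_pos_of_pos_of_lt_pi (by have := hs.1; positivity) (by nlinarith [hs.2, Real.pi_pos])
  rw [abs_of_pos hsin]
  have hM := gaussMoment_pos ha b
  rcases le_or_gt (1 / 4) a with h | h
  · have h1 := gaussMoment_mul_sin_le_of_quarter_le h (by linarith) hb1 hs
    have hw : Real.exp (-(Real.pi * r)) ^ 3 ≤ (3 / 20) ^ 3 := by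
      gcongr
      exact exp_neg_pi_mul_le hr
    have hMs := mul_pos hM hsin
    nlinarith
  · have hc : 4 ≤ a⁻¹ := by
      rw [le_inv_comm₀ (by norm_num) ha]; linarith
    have h1 := le_tsum_waveKernel hc hb0 hb1 hs
    have h2 := gaussMoment_le ha (by linarith : 0 ≤ b) hb1
    rw [sinSeries_eq_tsum_waveKernel ha b ⟨by linarith [hs.1], by linarith [hs.2]⟩]
    have h3 := mul_sq_mul_exp_lt hc
    have h4 : 1 ≤ Real.sqrt a⁻¹ := Real.one_le_sqrt.2 (by linarith)
    have hw : Real.exp (-(Real.pi * r)) ≤ Real.exp (-(Real.pi * (a⁻¹ / 2))) := by gcongr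
    calc 5 * Real.exp (-(Real.pi * r)) ^ 3 * (gaussMoment a b * Real.sin (2 * Real.pi * s))
        ≤ 5 * Real.exp (-(Real.pi * (a⁻¹ / 2))) ^ 3 *
          (11 * a⁻¹ ^ 2 * Real.sin (2 * Real.pi * s)) := by gcongr
      _ = 55 * a⁻¹ ^ 2 * Real.exp (-(Real.pi * (a⁻¹ / 2))) ^ 3 * Real.sin (2 * Real.pi * s) := by
        ring
      _ < 1 / 200 * Real.exp (-(Real.pi * a⁻¹ / 4)) * Real.sin (2 * Real.pi * s) := by gcongr
      _ ≤ ∑' k : ℤ, waveKernel a⁻¹ b (k + s) := h1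
      _ ≤ _ := le_mul_of_one_le_left (h1.trans' (by positivity)) h4

/-- For every `α ≥ 1`, `y ≥ 1/√2`, `x ∈ (0,1/2)`, the `x`-derivative of
`x ↦ θ̂_{x,y}(b(x,y);α)` is strictly positive. -/
theorem thetaHat_x_deriv_pos (α : ℝ) (hα : 1 ≤ α) (y : ℝ) (hy : 1 / Real.sqrt 2 ≤ y)
    (x : ℝ) (hx : x ∈ Set.Ioo (0 : ℝ) (1 / 2)) :
    0 < deriv (fun t => latticeThetaHat t y (bPoint t y) α) x := by
  have hα0 : 0 < α := by linarith
  have hy0 : 0 < y := lt_of_lt_of_le (by positivity) hy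
  have hy2 : 1 / 2 ≤ y ^ 2 := by
    have h := pow_le_pow_left₀ (by positivity) hy 2
    rwa [div_pow, Real.sq_sqrt (by norm_num), one_pow] at h
  have hy7 : 7 / 10 ≤ y := by nlinarith
  have hb0 : 1 / 4 ≤ (bPoint x y).2 := by
    simp only [bPoint]
    rw [le_div_iff₀ (by positivity)]
    linarith
  have hb1 : (bPoint x y).2 ≤ 1 / 2 := by
    simp only [bPoint]
    rw [div_le_iff₀ (by positivity)]
    linarith
  have hr : 7 / 10 ≤ α * y := by nlinarith
  have har : (y / α)⁻¹ / 2 ≤ α * y := by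
    rw [inv_div, div_div, div_le_iff₀ (by positivity)]
    nlinarith
  have ha : 0 < y / α := by positivity
  have hneg := alternating_tsum_neg ha (by positivity : 0 < α * y) (exp_neg_pi_mul_le hr)
    (exp_pow_mul_gaussMoment_lt_sinSeries ha hr har hb0 hb1 hx)
  rw [(hasDerivAt_latticeThetaHat_bPoint hy0 hα0 x).deriv]
  exact mul_pos_of_neg_of_neg
    (mul_neg_of_neg_of_pos (by linarith [Real.pi_pos]) (Real.sqrt_pos.2 ha)) hneg
end
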